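/- arXiv:2512.24915 — 2 statements merged into one kernel-verified Lean document; each statement's English description precedes it below -/
import Mathlib

section
/- Let L > 0 and a, b, c > 0 be real numbers and let p : [0,L] → ℝ be continuous. Let M, N > 0 be constants with N ≤ (4M/L³)·σ(√M·L). Suppose α is a lower solution and β is an upper solution of problem (4.1),(1.2) satisfying 0 ≤ α(x) ≤ β(x) and 0 ≥ α''(x) ≥ β''(x) for all x ∈ [0,L], and suppose a + b·∫₀ᴸ β(t)dt ≤ M and c − b·min_{x∈[0,L]} β''(x) ≤ N. If in addition a + b·∫₀ᴸ α(t)dt + (L³/4)·c > (L³/4)·N + M − 4/L², then problem (4.1),(1.2) has exactly one solution w satisfying α ≤ w ≤ β and α'' ≥ w'' ≥ β'' on [0,L]. -/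
open Real

/-- The auxiliary function `σ(x) = 3x³ / (6x cosh x + 6x − 12 sinh x − x³)`. -/
noncomputable def sigmaFun (x : ℝ) : ℝ :=
  3 * x ^ 3 / (6 * x * Real.cosh x + 6 * x - 12 * Real.sinh x - x ^ 3)

/-- `w` is a (classical, C⁴ on `[0,L]`) solution of problem (4.1),(1.2):
`w'''' − (a + b∫₀ᴸ w) w'' + c∫₀ᴸ w = p` on `(0,L)` with Navier boundary
conditions `w(0) = w(L) = w''(0) = w''(L) = 0`. -/
def IsMelanSolution (L a b c : ℝ) (p w : ℝ → ℝ) : Prop :=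
  ContDiffOn ℝ 4 w (Set.Icc 0 L) ∧
  (∀ x ∈ Set.Ioo (0:ℝ) L,
    iteratedDerivWithin 4 w (Set.Icc 0 L) x
      - (a + b * ∫ t in (0:ℝ)..L, w t) * iteratedDerivWithin 2 w (Set.Icc 0 L) x
      + c * ∫ t in (0:ℝ)..L, w t = p x) ∧
  w 0 = 0 ∧ w L = 0 ∧
  iteratedDerivWithin 2 w (Set.Icc 0 L) 0 = 0 ∧
  iteratedDerivWithin 2 w (Set.Icc 0 L) L = 0

/-- `α` is a lower solution of problem (4.1),(1.2). -/
def IsMelanLowerSolution (L a b c : ℝ) (p α : ℝ → ℝ) : Prop :=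
  ContDiffOn ℝ 4 α (Set.Icc 0 L) ∧
  (∀ x ∈ Set.Ioo (0:ℝ) L,
    iteratedDerivWithin 4 α (Set.Icc 0 L) x
      - (a + b * ∫ t in (0:ℝ)..L, α t) * iteratedDerivWithin 2 α (Set.Icc 0 L) x
      + c * ∫ t in (0:ℝ)..L, α t ≤ p x) ∧
  α 0 = 0 ∧ α L = 0 ∧
  iteratedDerivWithin 2 α (Set.Icc 0 L) 0 = 0 ∧
  iteratedDerivWithin 2 α (Set.Icc 0 L) L = 0

/-- `β` is an upper solution of problem (4.1),(1.2). -/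
def IsMelanUpperSolution (L a b c : ℝ) (p β : ℝ → ℝ) : Prop :=
  ContDiffOn ℝ 4 β (Set.Icc 0 L) ∧
  (∀ x ∈ Set.Ioo (0:ℝ) L,
    p x ≤ iteratedDerivWithin 4 β (Set.Icc 0 L) x
      - (a + b * ∫ t in (0:ℝ)..L, β t) * iteratedDerivWithin 2 β (Set.Icc 0 L) x
      + c * ∫ t in (0:ℝ)..L, β t) ∧
  β 0 = 0 ∧ β L = 0 ∧
  iteratedDerivWithin 2 β (Set.Icc 0 L) 0 = 0 ∧
  iteratedDerivWithin 2 β (Set.Icc 0 L) L = 0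

open intervalIntegral Set

/-- On `[a, b]`, the functions `f₁` and `f₂` are the first and second derivatives of `f`, with
continuity up to the boundary. -/
structure HasTwoDerivsOn (a b : ℝ) (f f₁ f₂ : ℝ → ℝ) : Prop where
  cont : ContinuousOn f (Icc a b)
  cont₁ : ContinuousOn f₁ (Icc a b)
  cont₂ : ContinuousOn f₂ (Icc a b)
  deriv : ∀ x ∈ Ioo a b, HasDerivAt f (f₁ x) x
  deriv₁ : ∀ x ∈ Ioo a b, HasDerivAt f₁ (f₂ x) x

namespace HasTwoDerivsOn

variable {a b L : ℝ} {u u₁ u₂ v v₁ v₂ : ℝ → ℝ}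

theorem mono (h : HasTwoDerivsOn a b u u₁ u₂) {a' b' : ℝ} (ha : a ≤ a') (hb : b' ≤ b) :
    HasTwoDerivsOn a' b' u u₁ u₂ :=
  ⟨h.cont.mono (Icc_subset_Icc ha hb), h.cont₁.mono (Icc_subset_Icc ha hb),
    h.cont₂.mono (Icc_subset_Icc ha hb), fun x hx => h.deriv x (Ioo_subset_Ioo ha hb hx),
    fun x hx => h.deriv₁ x (Ioo_subset_Ioo ha hb hx)⟩

theorem of_global (h : ∀ x, HasDerivAt u (u₁ x) x) (h₁ : ∀ x, HasDerivAt u₁ (u₂ x) x)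
    (h₂ : Continuous u₂) : HasTwoDerivsOn a b u u₁ u₂ :=
  ⟨fun x _ => (h x).continuousAt.continuousWithinAt,
    fun x _ => (h₁ x).continuousAt.continuousWithinAt, h₂.continuousOn,
    fun x _ => h x, fun x _ => h₁ x⟩

theorem sub (hu : HasTwoDerivsOn a b u u₁ u₂) (hv : HasTwoDerivsOn a b v v₁ v₂) :
    HasTwoDerivsOn a b (fun x => u x - v x) (fun x => u₁ x - v₁ x) (fun x => u₂ x - v₂ x) :=
  ⟨hu.cont.sub hv.cont, hu.cont₁.sub hv.cont₁, hu.cont₂.sub hv.cont₂,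
    fun x hx => (hu.deriv x hx).sub (hv.deriv x hx),
    fun x hx => (hu.deriv₁ x hx).sub (hv.deriv₁ x hx)⟩

theorem const_mul (c : ℝ) (hu : HasTwoDerivsOn a b u u₁ u₂) :
    HasTwoDerivsOn a b (fun x => c * u x) (fun x => c * u₁ x) (fun x => c * u₂ x) :=
  ⟨continuousOn_const.mul hu.cont, continuousOn_const.mul hu.cont₁,
    continuousOn_const.mul hu.cont₂, fun x hx => (hu.deriv x hx).const_mul c,
    fun x hx => (hu.deriv₁ x hx).const_mul c⟩

theorem add (hu : HasTwoDerivsOn a b u u₁ u₂) (hv : HasTwoDerivsOn a b v v₁ v₂) :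
    HasTwoDerivsOn a b (fun x => u x + v x) (fun x => u₁ x + v₁ x) (fun x => u₂ x + v₂ x) :=
  ⟨hu.cont.add hv.cont, hu.cont₁.add hv.cont₁, hu.cont₂.add hv.cont₂,
    fun x hx => (hu.deriv x hx).add (hv.deriv x hx),
    fun x hx => (hu.deriv₁ x hx).add (hv.deriv₁ x hx)⟩

/-- Green's second identity in one dimension. -/
theorem green (hab : a ≤ b) (hu : HasTwoDerivsOn a b u u₁ u₂) (hv : HasTwoDerivsOn a b v v₁ v₂) :
    ∫ x in a..b, (u x * v₂ x - u₂ x * v x) =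
      (u b * v₁ b - u₁ b * v b) - (u a * v₁ a - u₁ a * v a) := by
  refine integral_eq_sub_of_hasDerivAt_of_le (f := fun x => u x * v₁ x - u₁ x * v x) hab
    ((hu.cont.mul hv.cont₁).sub (hu.cont₁.mul hv.cont)) (fun x hx => ?_) ?_
  · exact (((hu.deriv x hx).mul (hv.deriv₁ x hx)).sub
      ((hu.deriv₁ x hx).mul (hv.deriv x hx))).congr_deriv (by ring)
  · exact ((hu.cont.mul hv.cont₂).sub (hu.cont₂.mul hv.cont)).intervalIntegrable_of_Icc hab

/-- A function vanishing at the ends of an interval with nonpositive second derivative is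
nonnegative. -/
theorem nonneg_of_deriv2_nonpos (hL : 0 < L) (hu : HasTwoDerivsOn 0 L u u₁ u₂) (h0 : u 0 = 0)
    (h1 : u L = 0) (h : ∀ x ∈ Icc 0 L, u₂ x ≤ 0) : ∀ x ∈ Icc 0 L, 0 ≤ u x := by
  intro x hx
  have hl : HasTwoDerivsOn 0 x (fun s => s) (fun _ => 1) (fun _ => 0) :=
    of_global (fun s => hasDerivAt_id s) (fun s => hasDerivAt_const s 1) continuous_const
  have hr : HasTwoDerivsOn x L (fun s => L - s) (fun _ => -1) (fun _ => 0) :=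
    of_global (fun s => by simpa using (hasDerivAt_id s).const_sub L)
      (fun s => hasDerivAt_const s (-1)) continuous_const
  have e1 := green hx.1 hl (hu.mono le_rfl hx.2)
  have e2 := green hx.2 hr (hu.mono hx.1 le_rfl)
  have i1 : 0 ≤ ∫ s in (0:ℝ)..x, -(s * u₂ s - 0 * u s) := by
    refine integral_nonneg hx.1 fun s hs => ?_
    have := mul_nonneg hs.1 (neg_nonneg.2 (h s ⟨hs.1, hs.2.trans hx.2⟩))
    linarith
  have i2 : 0 ≤ ∫ s in x..L, -((L - s) * u₂ s - 0 * u s) := by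
    refine integral_nonneg hx.2 fun s hs => ?_
    have := mul_nonneg (sub_nonneg.2 hs.2) (neg_nonneg.2 (h s ⟨hx.1.trans hs.1, hs.2⟩))
    linarith
  rw [integral_neg, e1] at i1
  rw [integral_neg, e2] at i2
  have := mul_nonneg (sub_nonneg.2 hx.2) i1
  have := mul_nonneg hx.1 i2
  simp only [h0, h1] at *
  refine nonneg_of_mul_nonneg_right (a := L) ?_ hL
  linarith

/-- Green's representation of the solution of `-v'' + m² v = f`, `v(0) = v(L) = 0`. -/
theorem green_representation (m : ℝ) (hv : HasTwoDerivsOn 0 L v v₁ v₂) (h0 : v 0 = 0)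
    (h1 : v L = 0) {x : ℝ} (hx : x ∈ Icc 0 L) :
    m * sinh (m * L) * v x =
      sinh (m * (L - x)) * (∫ s in (0:ℝ)..x, sinh (m * s) * (m ^ 2 * v s - v₂ s)) +
      sinh (m * x) * ∫ s in x..L, sinh (m * (L - s)) * (m ^ 2 * v s - v₂ s) := by
  have hlin : ∀ s, HasDerivAt (fun s => m * s) m s := fun s => by
    simpa using (hasDerivAt_id s).const_mul m
  have hrev : ∀ s, HasDerivAt (fun s => m * (L - s)) (-m) s := fun s => by
    simpa using ((hasDerivAt_id s).const_sub L).const_mul m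
  have hl : HasTwoDerivsOn 0 x (fun s => sinh (m * s)) (fun s => m * cosh (m * s))
      (fun s => m ^ 2 * sinh (m * s)) :=
    of_global (fun s => (hlin s).sinh.congr_deriv (by ring))
      (fun s => ((hlin s).cosh.const_mul m).congr_deriv (by ring)) (by fun_prop)
  have hr : HasTwoDerivsOn x L (fun s => sinh (m * (L - s))) (fun s => -m * cosh (m * (L - s)))
      (fun s => m ^ 2 * sinh (m * (L - s))) :=
    of_global (fun s => (hrev s).sinh.congr_deriv (by ring))
      (fun s => ((hrev s).cosh.const_mul (-m)).congr_deriv (by ring)) (by fun_prop)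
  have e1 := green hx.1 hl (hv.mono le_rfl hx.2)
  have e2 := green hx.2 hr (hv.mono hx.1 le_rfl)
  have i1 : ∫ s in (0:ℝ)..x, sinh (m * s) * (m ^ 2 * v s - v₂ s) =
      -∫ s in (0:ℝ)..x, (sinh (m * s) * v₂ s - m ^ 2 * sinh (m * s) * v s) := by
    rw [← integral_neg]; congr 1; ext s; ring
  have i2 : ∫ s in x..L, sinh (m * (L - s)) * (m ^ 2 * v s - v₂ s) =
      -∫ s in x..L, (sinh (m * (L - s)) * v₂ s - m ^ 2 * sinh (m * (L - s)) * v s) := by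
    rw [← integral_neg]; congr 1; ext s; ring
  have hs : sinh (m * L) =
      sinh (m * (L - x)) * cosh (m * x) + cosh (m * (L - x)) * sinh (m * x) := by
    rw [← sinh_add]; ring_nf
  rw [i1, i2, e1, e2, h0, h1, hs]
  simp only [mul_zero, sub_self, sinh_zero]
  ring

/-- Maximum principle for `-v'' + m² v`. -/
theorem nonneg_of_helmholtz_nonneg {m : ℝ} (hm : 0 < m) (hL : 0 < L)
    (hv : HasTwoDerivsOn 0 L v v₁ v₂) (h0 : v 0 = 0) (h1 : v L = 0)
    (h : ∀ x ∈ Icc 0 L, 0 ≤ m ^ 2 * v x - v₂ x) : ∀ x ∈ Icc 0 L, 0 ≤ v x := by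
  intro x hx
  have e := green_representation m hv h0 h1 hx
  have hsinh : ∀ y, 0 ≤ y → 0 ≤ sinh (m * y) := fun y hy =>
    sinh_nonneg_iff.2 (mul_nonneg hm.le hy)
  refine nonneg_of_mul_nonneg_right (a := m * sinh (m * L)) ?_
    (mul_pos hm (sinh_pos_iff.2 (mul_pos hm hL)))
  rw [e]
  refine add_nonneg (mul_nonneg (hsinh _ (sub_nonneg.2 hx.2)) (integral_nonneg hx.1 fun s hs => ?_))
    (mul_nonneg (hsinh _ hx.1) (integral_nonneg hx.2 fun s hs => ?_))
  · exact mul_nonneg (hsinh _ hs.1) (h s ⟨hs.1, hs.2.trans hx.2⟩)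
  · exact mul_nonneg (hsinh _ (sub_nonneg.2 hs.2)) (h s ⟨hx.1.trans hs.1, hs.2⟩)

end HasTwoDerivsOn

/-- The denominator `6x cosh x + 6x − 12 sinh x − x³` grows at least like `x⁵`. -/
theorem sigma_denominator_mono {x y : ℝ} (hx : 0 ≤ x) (hxy : x ≤ y) :
    (6 * x * cosh x + 6 * x - 12 * sinh x - x ^ 3) * y ^ 5 ≤
      (6 * y * cosh y + 6 * y - 12 * sinh y - y ^ 3) * x ^ 5 := by
  have key : ∀ z : ℝ, HasSum (fun n : ℕ => 6 * z * (z ^ (2 * n) / ((2 * n).factorial : ℝ))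
      - 12 * (z ^ (2 * n + 1) / ((2 * n + 1).factorial : ℝ))
      + (if n = 0 then 6 * z else 0) - (if n = 1 then z ^ 3 else 0))
      (6 * z * cosh z - 12 * sinh z + 6 * z - z ^ 3) := fun z =>
    ((((hasSum_cosh z).mul_left (6 * z)).sub ((hasSum_sinh z).mul_left 12)).add
      (hasSum_ite_eq 0 (6 * z))).sub (hasSum_ite_eq 1 (z ^ 3))
  have hle := hasSum_le (fun n => ?_) ((key x).mul_right (y ^ 5)) ((key y).mul_right (x ^ 5))
  · linarith
  have hy := hx.trans hxy
  match n with
  | 0 => norm_num; linarith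
  | 1 => norm_num [Nat.factorial]; ring_nf; rfl
  | n + 2 =>
    have e : ∀ z w : ℝ, (6 * z * (z ^ (2 * (n + 2)) / ((2 * (n + 2)).factorial : ℝ))
      - 12 * (z ^ (2 * (n + 2) + 1) / ((2 * (n + 2) + 1).factorial : ℝ))
      + (if n + 2 = 0 then 6 * z else 0) - (if n + 2 = 1 then z ^ 3 else 0)) * w ^ 5 =
      (6 * (2 * n + 3) / ((2 * (n + 2) + 1).factorial : ℝ)) * (z * w) ^ 5 * z ^ (2 * n) := by
      intro z w
      have hf : ((2 * (n + 2) + 1).factorial : ℝ)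
          = (2 * n + 5) * ((2 * (n + 2)).factorial : ℝ) := by
        rw [Nat.factorial_succ]; push_cast; ring
      have : ((2 * (n + 2)).factorial : ℝ) ≠ 0 := by positivity
      have : (2 * n + 5 : ℝ) ≠ 0 := by positivity
      rw [if_neg (by lia), if_neg (by lia), hf]
      field_simp
      ring
    rw [e, e, mul_comm y x]
    gcongr

/-- The solution of `-u'' + m² u = 1`, `u(0) = u(L) = 0`. -/
noncomputable def helmholtzUnit (m L x : ℝ) : ℝ :=
  (1 - cosh (m * x) + (cosh (m * L) - 1) / sinh (m * L) * sinh (m * x)) / m ^ 2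

/-- The solution of `-u'' + m² u = x (L - x) / 2`, `u(0) = u(L) = 0`. -/
noncomputable def helmholtzParabola (m L x : ℝ) : ℝ :=
  (x * (L - x) / 2 - helmholtzUnit m L x) / m ^ 2

section Kernel

variable {m L : ℝ}

theorem helmholtzUnit_zero : helmholtzUnit m L 0 = 0 := by simp [helmholtzUnit]

theorem helmholtzUnit_reflect (hm : 0 < m) (hL : 0 < L) (x : ℝ) :
    helmholtzUnit m L (L - x) = helmholtzUnit m L x := by
  have hS : sinh (m * L) ≠ 0 := (sinh_pos_iff.2 (mul_pos hm hL)).ne'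
  have hsq := cosh_sq (m * L)
  rw [helmholtzUnit, helmholtzUnit, mul_sub, cosh_sub, sinh_sub]
  congr 1
  field_simp
  linear_combination (-sinh (m * x)) * hsq

theorem helmholtzUnit_right (hm : 0 < m) (hL : 0 < L) : helmholtzUnit m L L = 0 := by
  have := helmholtzUnit_reflect hm hL 0
  rwa [sub_zero, helmholtzUnit_zero] at this

theorem hasTwoDerivsOn_helmholtzUnit (hm : 0 < m) :
    ∃ u₁, HasTwoDerivsOn 0 L (helmholtzUnit m L) u₁
      (fun x => m ^ 2 * helmholtzUnit m L x - 1) := by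
  have hlin : ∀ s, HasDerivAt (fun s => m * s) m s := fun s => by
    simpa using (hasDerivAt_id s).const_mul m
  refine ⟨fun x => (-(m * sinh (m * x))
    + (cosh (m * L) - 1) / sinh (m * L) * (m * cosh (m * x))) / m ^ 2,
    HasTwoDerivsOn.of_global (fun x => ?_) (fun x => ?_) ?_⟩
  · exact ((((hlin x).cosh.const_sub 1).add ((hlin x).sinh.const_mul _)).div_const _).congr_deriv
      (by ring)
  · refine ((((hlin x).sinh.const_mul m).neg.add
      (((hlin x).cosh.const_mul m).const_mul _)).div_const _).congr_deriv ?_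
    rw [helmholtzUnit]
    field_simp
    ring
  · unfold helmholtzUnit
    fun_prop

theorem helmholtzParabola_zero : helmholtzParabola m L 0 = 0 := by
  simp [helmholtzParabola, helmholtzUnit_zero]

theorem helmholtzParabola_right (hm : 0 < m) (hL : 0 < L) : helmholtzParabola m L L = 0 := by
  simp [helmholtzParabola, helmholtzUnit_right hm hL]

theorem helmholtzParabola_reflect (hm : 0 < m) (hL : 0 < L) (x : ℝ) :
    helmholtzParabola m L (L - x) = helmholtzParabola m L x := by
  rw [helmholtzParabola, helmholtzParabola, helmholtzUnit_reflect hm hL]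
  ring

theorem hasTwoDerivsOn_parabola :
    HasTwoDerivsOn 0 L (fun x => x * (L - x) / 2) (fun x => L / 2 - x) (fun _ => -1) :=
  HasTwoDerivsOn.of_global
    (fun x => (((hasDerivAt_id x).mul ((hasDerivAt_id x).const_sub L)).div_const 2).congr_deriv
      (by simp; ring))
    (fun x => (hasDerivAt_id x).const_sub (L / 2)) continuous_const

theorem hasTwoDerivsOn_helmholtzParabola (hm : 0 < m) :
    ∃ g₁, HasTwoDerivsOn 0 L (helmholtzParabola m L) g₁
      (fun x => m ^ 2 * helmholtzParabola m L x - x * (L - x) / 2) := by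
  obtain ⟨u₁, hu⟩ := hasTwoDerivsOn_helmholtzUnit (L := L) hm
  have h := (hasTwoDerivsOn_parabola.sub hu).const_mul (1 / m ^ 2)
  refine ⟨fun x => 1 / m ^ 2 * (L / 2 - x - u₁ x), ?_⟩
  convert h using 1 <;> ext x <;> simp only [helmholtzParabola] <;> field_simp
  ring

theorem helmholtzUnit_nonneg (hm : 0 < m) (hL : 0 < L) {x : ℝ} (hx : x ∈ Icc 0 L) :
    0 ≤ helmholtzUnit m L x := by
  obtain ⟨u₁, hu⟩ := hasTwoDerivsOn_helmholtzUnit (L := L) hm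
  exact hu.nonneg_of_helmholtz_nonneg hm hL helmholtzUnit_zero (helmholtzUnit_right hm hL)
    (fun x _ => by simp) x hx

theorem helmholtzParabola_nonneg (hm : 0 < m) (hL : 0 < L) {x : ℝ} (hx : x ∈ Icc 0 L) :
    0 ≤ helmholtzParabola m L x := by
  obtain ⟨u₁, hu⟩ := hasTwoDerivsOn_helmholtzParabola (L := L) hm
  refine hu.nonneg_of_helmholtz_nonneg hm hL helmholtzParabola_zero
    (helmholtzParabola_right hm hL) (fun x hx => ?_) x hx
  have := mul_nonneg hx.1 (sub_nonneg.2 hx.2)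
  linarith

theorem helmholtzUnit_le (x : ℝ) :
    helmholtzUnit m L x ≤ (cosh (m * L) - 1) / sinh (m * L) / m ^ 2 * sinh (m * x) := by
  have := one_le_cosh (m * x)
  rw [helmholtzUnit, div_mul_eq_mul_div (_ / _)]
  exact div_le_div_of_nonneg_right (by linarith) (sq_nonneg m)

theorem sinh_le_self_mul_cosh {z : ℝ} (hz : 0 ≤ z) : sinh z ≤ z * cosh z := by
  have hd : ∀ x, HasDerivAt (fun x => x * cosh x - sinh x) (x * sinh x) x := fun x =>
    (((hasDerivAt_id x).mul (hasDerivAt_cosh x)).sub (hasDerivAt_sinh x)).congr_deriv (by simp)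
  have hmono : MonotoneOn (fun x => x * cosh x - sinh x) (Ici 0) := by
    refine monotoneOn_of_deriv_nonneg (convex_Ici 0) (by fun_prop) (by fun_prop) fun x hx => ?_
    rw [interior_Ici] at hx
    rw [(hd x).deriv]
    exact mul_nonneg (le_of_lt hx) (sinh_nonneg_iff.2 (le_of_lt hx))
  simpa using hmono self_mem_Ici hz hz

theorem two_mul_cosh_sub_one_le {y : ℝ} (hy : 0 ≤ y) : 2 * (cosh y - 1) ≤ y * sinh y := by
  have h := sinh_le_self_mul_cosh (z := y / 2) (by positivity)
  have hs : 0 ≤ sinh (y / 2) := sinh_nonneg_iff.2 (by positivity)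
  have e1 : cosh y = cosh (y / 2) ^ 2 + sinh (y / 2) ^ 2 := by
    rw [← cosh_two_mul]; ring_nf
  have e2 : sinh y = 2 * sinh (y / 2) * cosh (y / 2) := by
    rw [← sinh_two_mul]; ring_nf
  have := cosh_sq (y / 2)
  rw [e1, e2]
  nlinarith [mul_le_mul_of_nonneg_left h hs]

theorem helmholtzParabola_le (hm : 0 < m) {x : ℝ} (hx : x ∈ Icc 0 L) :
    helmholtzParabola m L x ≤
      (L / (2 * m) - (cosh (m * L) - 1) / sinh (m * L) / m ^ 2) / m ^ 2 * sinh (m * x) := by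
  rw [helmholtzParabola, div_mul_eq_mul_div]
  gcongr
  rw [helmholtzUnit]
  have hy : 0 ≤ m * x := mul_nonneg hm.le hx.1
  have h1 := two_mul_cosh_sub_one_le hy
  have h2 := mul_nonneg (mul_nonneg hm.le (sub_nonneg.2 hx.2))
    (sub_nonneg.2 (self_le_sinh_iff.2 hy))
  generalize (cosh (m * L) - 1) / sinh (m * L) = t
  have key : m ^ 2 * (x * (L - x) / 2) - (1 - cosh (m * x)) ≤ m * L / 2 * sinh (m * x) := by
    nlinarith
  have e : (L / (2 * m) - t / m ^ 2) * sinh (m * x) - (x * (L - x) / 2 -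
      (1 - cosh (m * x) + t * sinh (m * x)) / m ^ 2) =
      (m * L / 2 * sinh (m * x) - (m ^ 2 * (x * (L - x) / 2) - (1 - cosh (m * x)))) / m ^ 2 := by
    field_simp
    ring
  have := div_nonneg (sub_nonneg.2 key) (sq_nonneg m)
  linarith

theorem integral_helmholtzParabola (hm : 0 < m) (hL : 0 < L) :
    ∫ s in (0:ℝ)..L, helmholtzParabola m L s =
      L ^ 3 / (12 * m ^ 2)
        - (L - 2 * ((cosh (m * L) - 1) / sinh (m * L)) / m) / m ^ 4 := by
  have hS : sinh (m * L) ≠ 0 := (sinh_pos_iff.2 (mul_pos hm hL)).ne'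
  have hsq := cosh_sq (m * L)
  have hlin : ∀ s, HasDerivAt (fun s => m * s) m s := fun s => by
    simpa using (hasDerivAt_id s).const_mul m
  have hd : ∀ s, HasDerivAt (fun s => (L * s ^ 2 / 4 - s ^ 3 / 6 -
      (s - sinh (m * s) / m + (cosh (m * L) - 1) / sinh (m * L) * (cosh (m * s) / m)) / m ^ 2)
        / m ^ 2) (helmholtzParabola m L s) s := by
    intro s
    refine (((((((hasDerivAt_id s).pow 2).const_mul L).div_const 4).sub
      (((hasDerivAt_id s).pow 3).div_const 6)).sub
      ((((hasDerivAt_id s).sub ((hlin s).sinh.div_const m)).add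
        (((hlin s).cosh.div_const m).const_mul
          ((cosh (m * L) - 1) / sinh (m * L)))).div_const (m ^ 2))).div_const (m ^ 2)).congr_deriv ?_
    simp only [helmholtzParabola, helmholtzUnit, id]
    field_simp
    ring
  have hc : Continuous (helmholtzParabola m L) := by
    unfold helmholtzParabola helmholtzUnit; fun_prop
  rw [integral_eq_sub_of_hasDerivAt (fun s _ => hd s) (hc.intervalIntegrable _ _)]
  simp only [mul_zero, sinh_zero, cosh_zero]
  generalize sinh (m * L) = S at *
  generalize cosh (m * L) = C at *
  field_simp
  linear_combination (-288) * hsq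

theorem helmholtzUnit_mul_helmholtzParabola_le (hm : 0 < m) (hL : 0 < L) {x s : ℝ}
    (hx : x ∈ Icc 0 L) (hs : s ∈ Icc 0 L) :
    helmholtzUnit m L x * helmholtzParabola m L s ≤
      (cosh (m * L) - 1) / sinh (m * L) / m ^ 2 *
      ((L / (2 * m) - (cosh (m * L) - 1) / sinh (m * L) / m ^ 2) / m ^ 2) *
      (sinh (m * x) * sinh (m * s)) :=
  (mul_le_mul (helmholtzUnit_le x) (helmholtzParabola_le hm hs)
    (helmholtzParabola_nonneg hm hL hs)
    ((helmholtzUnit_nonneg hm hL hx).trans (helmholtzUnit_le x))).trans_eq (by ring)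

variable {v v₁ v₂ : ℝ → ℝ}

/-- Testing `-v'' + m² v` against the kernel recovers the mean of `v` against the parabola. -/
theorem integral_parabola_mul (hm : 0 < m) (hL : 0 < L) (hv : HasTwoDerivsOn 0 L v v₁ v₂)
    (h0 : v 0 = 0) (h1 : v L = 0) :
    ∫ x in (0:ℝ)..L, x * (L - x) / 2 * v x =
      ∫ x in (0:ℝ)..L, helmholtzParabola m L x * (m ^ 2 * v x - v₂ x) := by
  obtain ⟨g₁, hg⟩ := hasTwoDerivsOn_helmholtzParabola (L := L) hm
  have e := hg.green hL.le hv
  rw [h0, h1, helmholtzParabola_zero, helmholtzParabola_right hm hL] at e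
  rw [← sub_eq_zero, ← integral_sub]
  · simp only [zero_mul, mul_zero, sub_zero] at e
    rw [← e]
    congr 1
    ext x
    ring
  · exact ContinuousOn.intervalIntegrable_of_Icc hL.le
      ((hasTwoDerivsOn_parabola.cont).mul hv.cont)
  · exact ContinuousOn.intervalIntegrable_of_Icc hL.le
      (hg.cont.mul ((continuousOn_const.mul hv.cont).sub hv.cont₂))

/-- Maximum principle for the nonlocal operator `-v'' + m² v + N ∫ x (L - x) / 2 · v`. -/
theorem nonneg_of_nonlocal_nonneg (hm : 0 < m) (hL : 0 < L) {N : ℝ} (hN0 : 0 ≤ N)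
    (hN : N * (6 * (m * L) * cosh (m * L) + 6 * (m * L) - 12 * sinh (m * L) - (m * L) ^ 3)
      ≤ 12 * m ^ 5)
    (hv : HasTwoDerivsOn 0 L v v₁ v₂) (h0 : v 0 = 0) (h1 : v L = 0) {D : ℝ}
    (hD : D = ∫ x in (0:ℝ)..L, x * (L - x) / 2 * v x)
    (h : ∀ x ∈ Icc 0 L, 0 ≤ m ^ 2 * v x - v₂ x + N * D) : ∀ x ∈ Icc 0 L, 0 ≤ v x := by
  obtain ⟨u₁, hu⟩ := hasTwoDerivsOn_helmholtzUnit (L := L) hm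
  obtain ⟨g₁, hg⟩ := hasTwoDerivsOn_helmholtzParabola (L := L) hm
  have hS : 0 < sinh (m * L) := sinh_pos_iff.2 (mul_pos hm hL)
  have hV := hv.add (hu.const_mul (N * D))
  set V := fun x => v x + N * D * helmholtzUnit m L x with hVdef
  set V₂ := fun x => v₂ x + N * D * (m ^ 2 * helmholtzUnit m L x - 1)
  have hVh : ∀ x, m ^ 2 * V x - V₂ x = m ^ 2 * v x - v₂ x + N * D := fun x => by
    simp only [V, V₂]; ring
  have hV0 : V 0 = 0 := by simp [V, h0, helmholtzUnit_zero]
  have hVL : V L = 0 := by simp [V, h1, helmholtzUnit_right hm hL]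
  set H := fun x => m ^ 2 * V x - V₂ x with hH
  have hHc : ContinuousOn H (Icc 0 L) := (continuousOn_const.mul hV.cont).sub hV.cont₂
  have hH0 : ∀ x ∈ Icc 0 L, 0 ≤ H x := fun x hx => by rw [hH]; simp only [hVh]; exact h x hx
  have hVnn := hV.nonneg_of_helmholtz_nonneg hm hL hV0 hVL hH0
  set K := ∫ s in (0:ℝ)..L, helmholtzParabola m L s with hK
  have hK0 : 0 ≤ K := integral_nonneg hL.le fun s hs => helmholtzParabola_nonneg hm hL hs
  have hKv := integral_helmholtzParabola hm hL
  rw [← hK] at hKv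
  have hgH : ∫ s in (0:ℝ)..L, helmholtzParabola m L s * H s = D * (1 + N * K) := by
    have e : ∀ s, helmholtzParabola m L s * H s =
        helmholtzParabola m L s * (m ^ 2 * v s - v₂ s) + N * D * helmholtzParabola m L s := by
      intro s; rw [hH]; simp only [hVh]; ring
    simp only [e]
    rw [integral_add, integral_const_mul, ← integral_parabola_mul hm hL hv h0 h1, ← hD, ← hK]
    · ring
    · exact ContinuousOn.intervalIntegrable_of_Icc hL.le
        (hg.cont.mul ((continuousOn_const.mul hv.cont).sub hv.cont₂))
    · exact ContinuousOn.intervalIntegrable_of_Icc hL.le (continuousOn_const.mul hg.cont)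
  intro x hx
  have hrep := hV.green_representation m hV0 hVL hx
  set A := (cosh (m * L) - 1) / sinh (m * L) / m ^ 2 *
      ((L / (2 * m) - (cosh (m * L) - 1) / sinh (m * L) / m ^ 2) / m ^ 2) with hA
  have hx' : L - x ∈ Icc 0 L := ⟨sub_nonneg.2 hx.2, by linarith [hx.1]⟩
  have hgHc : ContinuousOn (fun s => helmholtzUnit m L x * (helmholtzParabola m L s * H s))
      (Icc 0 L) := continuousOn_const.mul (hg.cont.mul hHc)
  have hI1 : ∫ s in (0:ℝ)..x, helmholtzUnit m L x * (helmholtzParabola m L s * H s) ≤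
      ∫ s in (0:ℝ)..x, A * sinh (m * (L - x)) * (sinh (m * s) * H s) := by
    refine integral_mono_on hx.1 ?_ ?_ fun s hs => ?_
    · exact (hgHc.mono (Icc_subset_Icc le_rfl hx.2)).intervalIntegrable_of_Icc hx.1
    · exact (continuousOn_const.mul ((by fun_prop : ContinuousOn (fun s => sinh (m * s)) _).mul
        (hHc.mono (Icc_subset_Icc le_rfl hx.2)))).intervalIntegrable_of_Icc hx.1
    · have hs' : s ∈ Icc 0 L := ⟨hs.1, hs.2.trans hx.2⟩
      have := helmholtzUnit_mul_helmholtzParabola_le hm hL hx' hs'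
      rw [helmholtzUnit_reflect hm hL] at this
      linarith [mul_le_mul_of_nonneg_right this (hH0 s hs')]
  have hI2 : ∫ s in x..L, helmholtzUnit m L x * (helmholtzParabola m L s * H s) ≤
      ∫ s in x..L, A * sinh (m * x) * (sinh (m * (L - s)) * H s) := by
    refine integral_mono_on hx.2 ?_ ?_ fun s hs => ?_
    · exact (hgHc.mono (Icc_subset_Icc hx.1 le_rfl)).intervalIntegrable_of_Icc hx.2
    · exact (continuousOn_const.mul ((by fun_prop :
        ContinuousOn (fun s => sinh (m * (L - s))) _).mul
        (hHc.mono (Icc_subset_Icc hx.1 le_rfl)))).intervalIntegrable_of_Icc hx.2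
    · have hs' : s ∈ Icc 0 L := ⟨hx.1.trans hs.1, hs.2⟩
      have hs'' : L - s ∈ Icc 0 L := ⟨sub_nonneg.2 hs'.2, by linarith [hs'.1]⟩
      have := helmholtzUnit_mul_helmholtzParabola_le hm hL hx hs''
      rw [helmholtzParabola_reflect hm hL] at this
      linarith [mul_le_mul_of_nonneg_right this (hH0 s hs')]
  have hsum : helmholtzUnit m L x * (D * (1 + N * K)) ≤ A * (m * sinh (m * L)) * V x := by
    have hi1 : IntervalIntegrable (fun s => helmholtzUnit m L x * (helmholtzParabola m L s * H s))
        MeasureTheory.volume 0 x :=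
      (hgHc.mono (Icc_subset_Icc le_rfl hx.2)).intervalIntegrable_of_Icc hx.1
    have hi2 : IntervalIntegrable (fun s => helmholtzUnit m L x * (helmholtzParabola m L s * H s))
        MeasureTheory.volume x L :=
      (hgHc.mono (Icc_subset_Icc hx.1 le_rfl)).intervalIntegrable_of_Icc hx.2
    rw [← hgH, ← integral_const_mul, ← integral_add_adjacent_intervals hi1 hi2]
    rw [integral_const_mul (A * _)] at hI1 hI2
    rw [mul_assoc A, hrep, hH] at *
    linarith
  have hNC : N * (A * (m * sinh (m * L))) ≤ 1 + N * K := by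
    have hsq := cosh_sq (m * L)
    have e : A * (m * sinh (m * L)) - K =
        (6 * (m * L) * cosh (m * L) + 6 * (m * L) - 12 * sinh (m * L) - (m * L) ^ 3)
          / (12 * m ^ 5) := by
      rw [hKv, hA]
      field_simp
      linear_combination (-24) * hsq
    have : N * (A * (m * sinh (m * L)) - K) ≤ 1 := by
      rw [e, ← mul_div_assoc, div_le_one (by positivity)]
      exact hN
    linarith
  have h3 : N * D * helmholtzUnit m L x * (1 + N * K) ≤ V x * (1 + N * K) := by
    have := mul_le_mul_of_nonneg_left hsum hN0
    have := mul_le_mul_of_nonneg_right hNC (hVnn x hx)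
    linarith
  have h4 := le_of_mul_le_mul_right h3 (by positivity)
  simp only [hVdef] at h4
  linarith

end Kernel

/-- The nonlocal maximum principle with a coefficient `k ≤ M`, under the bound on `N` expressed
through `sigmaFun`. -/
theorem nonneg_of_nonlocal_nonneg_of_sigma {L M N k : ℝ} (hL : 0 < L) (hM : 0 < M) (hN0 : 0 < N)
    (hN : N ≤ 4 * M / L ^ 3 * sigmaFun (√M * L)) (hk : 0 < k) (hkM : k ≤ M)
    {v v₁ v₂ : ℝ → ℝ} (hv : HasTwoDerivsOn 0 L v v₁ v₂) (h0 : v 0 = 0) (h1 : v L = 0) {D : ℝ}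
    (hD : D = ∫ x in (0:ℝ)..L, x * (L - x) / 2 * v x)
    (h : ∀ x ∈ Icc 0 L, 0 ≤ k * v x - v₂ x + N * D) : ∀ x ∈ Icc 0 L, 0 ≤ v x := by
  have hm : 0 < √k := sqrt_pos.2 hk
  have hm0 : 0 < √M := sqrt_pos.2 hM
  have hmm : √k ≤ √M := sqrt_le_sqrt hkM
  have hmono := sigma_denominator_mono (mul_nonneg hm.le hL.le)
    (mul_le_mul_of_nonneg_right hmm hL.le)
  refine nonneg_of_nonlocal_nonneg hm hL hN0.le ?_ hv h0 h1 hD fun x hx => ?_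
  · rw [sigmaFun] at hN
    set P := 6 * (√M * L) * cosh (√M * L) + 6 * (√M * L) - 12 * sinh (√M * L) - (√M * L) ^ 3
    set Q := 6 * (√k * L) * cosh (√k * L) + 6 * (√k * L) - 12 * sinh (√k * L) - (√k * L) ^ 3
    have hP : 0 < P := by
      have h1 : 0 < 3 * (√M * L) ^ 3 / P :=
        pos_of_mul_pos_right (hN0.trans_le hN) (by positivity)
      exact (div_pos_iff_of_pos_left (by positivity)).1 h1
    have hNP : N * P ≤ 12 * √M ^ 5 := by
      have e : 4 * M / L ^ 3 * (3 * (√M * L) ^ 3 / P) = 12 * √M ^ 5 / P := by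
        have : M = √M ^ 2 := (sq_sqrt hM.le).symm
        nth_rw 1 [this]
        field_simp
        ring
      rwa [e, le_div_iff₀ hP] at hN
    refine le_of_mul_le_mul_right ?_ (by positivity : 0 < (√M * L) ^ 5)
    calc N * Q * (√M * L) ^ 5 = N * (Q * (√M * L) ^ 5) := by ring
      _ ≤ N * (P * (√k * L) ^ 5) := mul_le_mul_of_nonneg_left hmono hN0.le
      _ = N * P * (√k * L) ^ 5 := by ring
      _ ≤ 12 * √M ^ 5 * (√k * L) ^ 5 := by gcongr
      _ = 12 * √k ^ 5 * (√M * L) ^ 5 := by ring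
  · rw [sq_sqrt hk.le]
    exact h x hx

/-- The Dirichlet problem `-V'' + m² V = h` on `[0, L]` has a solution. -/
theorem exists_helmholtz_solution {m L : ℝ} (hm : 0 < m) (hL : 0 < L) {h : ℝ → ℝ}
    (hh : Continuous h) :
    ∃ V V₁ : ℝ → ℝ, (∀ x, HasDerivAt V (V₁ x) x) ∧
      (∀ x, HasDerivAt V₁ (m ^ 2 * V x - h x) x) ∧ V 0 = 0 ∧ V L = 0 := by
  have hS : sinh (m * L) ≠ 0 := (sinh_pos_iff.2 (mul_pos hm hL)).ne'
  have hlin : ∀ s, HasDerivAt (fun s => m * s) m s := fun s => by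
    simpa using (hasDerivAt_id s).const_mul m
  have hrev : ∀ s, HasDerivAt (fun s => m * (L - s)) (-m) s := fun s => by
    simpa using ((hasDerivAt_id s).const_sub L).const_mul m
  have hI₁ : ∀ x, HasDerivAt (fun x => ∫ s in (0:ℝ)..x, sinh (m * s) * h s)
      (sinh (m * x) * h x) x := fun x =>
    ((by fun_prop : Continuous fun s => sinh (m * s) * h s).integral_hasStrictDerivAt
      0 x).hasDerivAt
  have hI₂ : ∀ x, HasDerivAt (fun x => ∫ s in L..x, sinh (m * (L - s)) * h s)
      (sinh (m * (L - x)) * h x) x := fun x =>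
    ((by fun_prop : Continuous fun s => sinh (m * (L - s)) * h s).integral_hasStrictDerivAt
      L x).hasDerivAt
  set I₁ := fun x => ∫ s in (0:ℝ)..x, sinh (m * s) * h s with hI₁d
  set I₂ := fun x => ∫ s in L..x, sinh (m * (L - s)) * h s with hI₂d
  refine ⟨fun x => (sinh (m * (L - x)) * I₁ x - sinh (m * x) * I₂ x) / (m * sinh (m * L)),
    fun x => -(cosh (m * (L - x)) * I₁ x + cosh (m * x) * I₂ x) / sinh (m * L),
    fun x => ?_, fun x => ?_, ?_, ?_⟩
  · refine ((((hrev x).sinh.mul (hI₁ x)).sub ((hlin x).sinh.mul (hI₂ x))).div_const _).congr_deriv ?_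
    field_simp
    ring
  · refine ((((hrev x).cosh.mul (hI₁ x)).add
      ((hlin x).cosh.mul (hI₂ x))).neg.div_const _).congr_deriv ?_
    have hs : sinh (m * L) =
        sinh (m * (L - x)) * cosh (m * x) + cosh (m * (L - x)) * sinh (m * x) := by
      rw [← sinh_add]; ring_nf
    have e : h x = sinh (m * L) * h x / sinh (m * L) := by field_simp
    nth_rw 3 [e]
    nth_rw 3 [hs]
    field_simp
    ring
  · simp [hI₁d]
  · simp [hI₂d]

/-- The Dirichlet problem `w'' = -V` on `[0, L]` has a solution. -/
theorem exists_poisson_solution {L : ℝ} (hL : 0 < L) {V : ℝ → ℝ} (hV : Continuous V) :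
    ∃ w w₁ : ℝ → ℝ, (∀ x, HasDerivAt w (w₁ x) x) ∧ (∀ x, HasDerivAt w₁ (-V x) x) ∧
      w 0 = 0 ∧ w L = 0 := by
  have h₁ : ∀ x, HasDerivAt (fun x => ∫ s in (0:ℝ)..x, V s) (V x) x := fun x =>
    (hV.integral_hasStrictDerivAt 0 x).hasDerivAt
  set F := fun x => ∫ s in (0:ℝ)..x, V s
  have hF : Continuous F := continuous_iff_continuousAt.2 fun x => (h₁ x).continuousAt
  have h₂ : ∀ x, HasDerivAt (fun x => ∫ s in (0:ℝ)..x, F s) (F x) x := fun x =>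
    (hF.integral_hasStrictDerivAt 0 x).hasDerivAt
  set G := fun x => ∫ s in (0:ℝ)..x, F s with hG
  refine ⟨fun x => G L / L * x - G x, fun x => G L / L - F x, fun x => ?_, fun x => ?_, ?_, ?_⟩
  · exact (((hasDerivAt_id x).const_mul (G L / L)).sub (h₂ x)).congr_deriv (by simp)
  · simpa using (h₁ x).const_sub (G L / L)
  · simp [hG]
  · simp only
    field_simp
    ring

theorem hasTwoDerivsOn_iteratedDerivWithin {L : ℝ} (hL : 0 < L) {w : ℝ → ℝ}
    (hw : ContDiffOn ℝ 4 w (Icc 0 L)) {n : ℕ} (hn : n + 2 ≤ 4) :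
    HasTwoDerivsOn 0 L (iteratedDerivWithin n w (Icc 0 L))
      (iteratedDerivWithin (n + 1) w (Icc 0 L)) (iteratedDerivWithin (n + 2) w (Icc 0 L)) := by
  have hu : UniqueDiffOn ℝ (Icc 0 L) := uniqueDiffOn_Icc hL
  have hc : ∀ k : ℕ, k ≤ 4 → ContinuousOn (iteratedDerivWithin k w (Icc 0 L)) (Icc 0 L) :=
    fun k hk => hw.continuousOn_iteratedDerivWithin (by exact_mod_cast hk) hu
  have hd : ∀ k : ℕ, k < 4 → ∀ x ∈ Ioo 0 L, HasDerivAt (iteratedDerivWithin k w (Icc 0 L))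
      (iteratedDerivWithin (k + 1) w (Icc 0 L) x) x := by
    intro k hk x hx
    have := (hw.differentiableOn_iteratedDerivWithin (m := k) (by exact_mod_cast hk) hu x
      (Ioo_subset_Icc_self hx)).hasDerivWithinAt
    rw [← iteratedDerivWithin_succ] at this
    exact this.hasDerivAt (Icc_mem_nhds hx.1 hx.2)
  exact ⟨hc _ (by lia), hc _ (by lia), hc _ (by lia), hd n (by lia), hd (n + 1) (by lia)⟩

/-- The mean of a function with vanishing boundary values in terms of its second derivative. -/
theorem integral_eq_integral_parabola_mul_neg {L : ℝ} (hL : 0 < L) {w w₁ w₂ : ℝ → ℝ}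
    (hw : HasTwoDerivsOn 0 L w w₁ w₂) (h0 : w 0 = 0) (h1 : w L = 0) :
    ∫ x in (0:ℝ)..L, w x = ∫ x in (0:ℝ)..L, x * (L - x) / 2 * -w₂ x := by
  have e := hasTwoDerivsOn_parabola.green hL.le hw
  rw [← sub_eq_zero, ← integral_sub]
  · rw [h0, h1] at e
    rw [← integral_congr (fun x _ => ?_)]
    · refine e.trans ?_
      ring
    · ring
  · exact hw.cont.intervalIntegrable_of_Icc hL.le
  · exact (hasTwoDerivsOn_parabola.cont.mul hw.cont₂.neg).intervalIntegrable_of_Icc hL.le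

/-- A `C⁴` function with Navier boundary conditions, viewed through `v = -w''`. -/
theorem navier_reduction {L : ℝ} (hL : 0 < L) {w : ℝ → ℝ} (hw : ContDiffOn ℝ 4 w (Icc 0 L))
    (h0 : w 0 = 0) (h1 : w L = 0) :
    HasTwoDerivsOn 0 L (fun x => -iteratedDerivWithin 2 w (Icc 0 L) x)
      (fun x => -iteratedDerivWithin 3 w (Icc 0 L) x)
      (fun x => -iteratedDerivWithin 4 w (Icc 0 L) x) ∧
    ∫ x in (0:ℝ)..L, w x =
      ∫ x in (0:ℝ)..L, x * (L - x) / 2 * -iteratedDerivWithin 2 w (Icc 0 L) x := by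
  have h2 := hasTwoDerivsOn_iteratedDerivWithin hL hw (n := 2) (by lia)
  have h2' := hasTwoDerivsOn_iteratedDerivWithin hL hw (n := 0) (by lia)
  refine ⟨by simpa using h2.const_mul (-1), ?_⟩
  rw [iteratedDerivWithin_zero] at h2'
  exact integral_eq_integral_parabola_mul_neg hL h2' h0 h1

theorem le_on_Icc_of_le_on_Ioo {L : ℝ} (hL : 0 < L) {f g : ℝ → ℝ} (hf : ContinuousOn f (Icc 0 L))
    (hg : ContinuousOn g (Icc 0 L)) (h : ∀ x ∈ Ioo 0 L, f x ≤ g x) :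
    ∀ x ∈ Icc 0 L, f x ≤ g x := by
  rw [← closure_Ioo hL.ne] at *
  exact fun x hx => le_on_closure h hf hg hx

theorem contDiff_four_of_hasDerivAt {w w₁ w₂ w₃ w₄ : ℝ → ℝ} (h₁ : ∀ x, HasDerivAt w (w₁ x) x)
    (h₂ : ∀ x, HasDerivAt w₁ (w₂ x) x) (h₃ : ∀ x, HasDerivAt w₂ (w₃ x) x)
    (h₄ : ∀ x, HasDerivAt w₃ (w₄ x) x) (hc : Continuous w₄) :
    ContDiff ℝ 4 w ∧ iteratedDeriv 2 w = w₂ ∧ iteratedDeriv 4 w = w₄ := by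
  have e₁ : deriv w = w₁ := funext fun x => (h₁ x).deriv
  have e₂ : deriv w₁ = w₂ := funext fun x => (h₂ x).deriv
  have e₃ : deriv w₂ = w₃ := funext fun x => (h₃ x).deriv
  have e₄ : deriv w₃ = w₄ := funext fun x => (h₄ x).deriv
  refine ⟨?_, by simp [iteratedDeriv_succ, e₁, e₂], by simp [iteratedDeriv_succ, e₁, e₂, e₃, e₄]⟩
  have step : ∀ (n : ℕ) {f f' : ℝ → ℝ}, (∀ x, HasDerivAt f (f' x) x) → ContDiff ℝ n f' →
      ContDiff ℝ (n + 1 : ℕ) f := by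
    intro n f f' hf hf'
    have e : deriv f = f' := funext fun x => (hf x).deriv
    push_cast
    refine contDiff_succ_iff_deriv.2 ⟨fun x => (hf x).differentiableAt, by simp, by rwa [e]⟩
  exact step 3 h₁ (step 2 h₂ (step 1 h₃ (step 0 h₄ (by exact_mod_cast contDiff_zero.2 hc))))

/-- Continuous dependence on `W` of the mean of the solution of the linear problem with frozen
mean `W`. -/
theorem continuous_integral_helmholtzParabola_mul {L a b c : ℝ} (hL : 0 < L) (ha : 0 < a)
    (hb : 0 < b) {q : ℝ → ℝ} (hq : Continuous q) :
    Continuous fun W : ℝ =>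
      ∫ s in (0:ℝ)..L, helmholtzParabola (√(a + b * |W|)) L s * (q s - c * W) := by
  have hpos : ∀ z : ℝ × ℝ, 0 < √(a + b * |z.1|) := fun z =>
    sqrt_pos.2 (add_pos_of_pos_of_nonneg ha (mul_nonneg hb.le (abs_nonneg _)))
  refine continuous_parametric_intervalIntegral_of_continuous'
    (f := fun W s => helmholtzParabola (√(a + b * |W|)) L s * (q s - c * W)) ?_ 0 L
  have hs : ∀ z : ℝ × ℝ, sinh (√(a + b * |z.1|) * L) ≠ 0 := fun z =>
    (sinh_pos_iff.2 (mul_pos (hpos z) hL)).ne'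
  have hp : ∀ z : ℝ × ℝ, √(a + b * |z.1|) ^ 2 ≠ 0 := fun z => pow_ne_zero 2 (hpos z).ne'
  simp only [Function.uncurry_def, helmholtzParabola, helmholtzUnit]
  fun_prop (disch := assumption)

/-- Existence of a solution whose mean lies between those of a lower and an upper solution. -/
theorem exists_melanSolution {L a b c : ℝ} (hL : 0 < L) (ha : 0 < a) (hb : 0 < b)
    {p α β : ℝ → ℝ} (hp : ContinuousOn p (Icc 0 L))
    (hα : IsMelanLowerSolution L a b c p α) (hβ : IsMelanUpperSolution L a b c p β)
    (hA0 : 0 ≤ ∫ t in (0:ℝ)..L, α t)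
    (hAB : ∫ t in (0:ℝ)..L, α t ≤ ∫ t in (0:ℝ)..L, β t) :
    ∃ w, IsMelanSolution L a b c p w ∧ ∫ t in (0:ℝ)..L, α t ≤ ∫ t in (0:ℝ)..L, w t ∧
      ∫ t in (0:ℝ)..L, w t ≤ ∫ t in (0:ℝ)..L, β t := by
  obtain ⟨hαC, hαI, hα0, hαL, hα20, hα2L⟩ := hα
  obtain ⟨hβC, hβI, hβ0, hβL, hβ20, hβ2L⟩ := hβ
  obtain ⟨hvα, hAφ⟩ := navier_reduction hL hαC hα0 hαL
  obtain ⟨hvβ, hBφ⟩ := navier_reduction hL hβC hβ0 hβL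
  set A := ∫ t in (0:ℝ)..L, α t
  set B := ∫ t in (0:ℝ)..L, β t
  obtain ⟨q, hq, hqp⟩ : ∃ q : ℝ → ℝ, Continuous q ∧ ∀ x ∈ Icc 0 L, q x = p x :=
    ⟨IccExtend hL.le (domRestrict (Icc 0 L) p),
      (continuousOn_iff_continuous_domRestrict.1 hp).Icc_extend',
      fun x hx => IccExtend_of_mem hL.le _ hx⟩
  set J : ℝ → ℝ := fun W =>
    ∫ s in (0:ℝ)..L, helmholtzParabola (√(a + b * |W|)) L s * (q s - c * W) with hJ
  have hJc : Continuous J := continuous_integral_helmholtzParabola_mul hL ha hb hq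
  have hpos : ∀ W, 0 ≤ W → 0 < a + b * W := fun W hW => by positivity
  have hgc : ∀ m, ContinuousOn (helmholtzParabola m L) (Icc 0 L) := fun m => by
    unfold helmholtzParabola helmholtzUnit; fun_prop
  have hJA : A ≤ J A := by
    have hk := hpos A hA0
    have hm := sqrt_pos.2 hk
    simp only [hJ, abs_of_nonneg hA0]
    nth_rw 1 [hAφ]
    rw [integral_parabola_mul hm hL hvα (by simpa using hα20) (by simpa using hα2L), sq_sqrt hk.le]
    refine integral_mono_on_of_le_Ioo hL.le ?_ ?_ fun s hs => ?_
    · exact ((hgc _).mul ((continuousOn_const.mul hvα.cont).sub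
        hvα.cont₂)).intervalIntegrable_of_Icc hL.le
    · exact ((hgc _).mul (by fun_prop)).intervalIntegrable_of_Icc hL.le
    · refine mul_le_mul_of_nonneg_left ?_
        (helmholtzParabola_nonneg hm hL (Ioo_subset_Icc_self hs))
      rw [hqp s (Ioo_subset_Icc_self hs)]
      linarith [hαI s hs]
  have hJB : J B ≤ B := by
    have hB0 := hA0.trans hAB
    have hk := hpos B hB0
    have hm := sqrt_pos.2 hk
    simp only [hJ, abs_of_nonneg hB0]
    nth_rw 3 [hBφ]
    rw [integral_parabola_mul hm hL hvβ (by simpa using hβ20) (by simpa using hβ2L), sq_sqrt hk.le]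
    refine integral_mono_on_of_le_Ioo hL.le ?_ ?_ fun s hs => ?_
    · exact ((hgc _).mul (by fun_prop)).intervalIntegrable_of_Icc hL.le
    · exact ((hgc _).mul ((continuousOn_const.mul hvβ.cont).sub
        hvβ.cont₂)).intervalIntegrable_of_Icc hL.le
    · refine mul_le_mul_of_nonneg_left ?_
        (helmholtzParabola_nonneg hm hL (Ioo_subset_Icc_self hs))
      rw [hqp s (Ioo_subset_Icc_self hs)]
      linarith [hβI s hs]
  obtain ⟨W, hW, hJW⟩ := intermediate_value_Icc' hAB (f := fun W => J W - W)
    (hJc.sub continuous_id).continuousOn (show (0:ℝ) ∈ Icc _ _ from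
      ⟨sub_nonpos.2 hJB, sub_nonneg.2 hJA⟩)
  have hW0 : 0 ≤ W := hA0.trans hW.1
  have hk := hpos W hW0
  have hm := sqrt_pos.2 hk
  obtain ⟨V, V₁, hV, hV₁, hV0, hVL⟩ := exists_helmholtz_solution hm hL
    (h := fun s => q s - c * W) (by fun_prop)
  have hVc : Continuous V := continuous_iff_continuousAt.2 fun x => (hV x).continuousAt
  obtain ⟨w, w₁, hw, hw₁, hw0, hwL⟩ := exists_poisson_solution hL hVc
  have hV2c : Continuous fun x => √(a + b * W) ^ 2 * V x - (q x - c * W) := by fun_prop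
  obtain ⟨hC4, e2, e4⟩ := contDiff_four_of_hasDerivAt hw hw₁ (fun x => (hV x).neg)
    (fun x => (hV₁ x).neg) hV2c.neg
  have d2 : ∀ x ∈ Icc 0 L, iteratedDerivWithin 2 w (Icc 0 L) x = -V x := fun x hx => by
    rw [iteratedDerivWithin_eq_iteratedDeriv (uniqueDiffOn_Icc hL)
      ((hC4.of_le (by norm_num)).contDiffAt) hx, e2]
  have d4 : ∀ x ∈ Icc 0 L, iteratedDerivWithin 4 w (Icc 0 L) x =
      -((a + b * W) * V x - (q x - c * W)) := fun x hx => by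
    rw [iteratedDerivWithin_eq_iteratedDeriv (uniqueDiffOn_Icc hL) hC4.contDiffAt hx, e4,
      sq_sqrt hk.le]
  have hint : ∫ t in (0:ℝ)..L, w t = W := by
    rw [integral_eq_integral_parabola_mul_neg hL
      (HasTwoDerivsOn.of_global hw hw₁ hVc.neg) hw0 hwL]
    simp only [neg_neg]
    rw [integral_parabola_mul hm hL (HasTwoDerivsOn.of_global hV hV₁ hV2c) hV0 hVL]
    simp only [sub_sub_cancel]
    refine sub_eq_zero.1 (Eq.trans ?_ hJW)
    simp only [hJ, abs_of_nonneg hW0]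
  refine ⟨w, ⟨hC4.contDiffOn, fun x hx => ?_, hw0, hwL, ?_, ?_⟩, ?_⟩
  · have hx' := Ioo_subset_Icc_self hx
    rw [hint, d2 x hx', d4 x hx', hqp x hx']
    ring
  · rw [d2 0 (left_mem_Icc.2 hL.le), hV0, neg_zero]
  · rw [d2 L (right_mem_Icc.2 hL.le), hVL, neg_zero]
  · rw [hint]
    exact hW

/-- The mean of a concave solution dominates the mean of every solution. -/
theorem melanSolution_integral_le {L a b c : ℝ} (hL : 0 < L) (ha : 0 < a) (hb : 0 < b)
    (hc : 0 < c) {p w w' : ℝ → ℝ} (hw : IsMelanSolution L a b c p w)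
    (hw' : IsMelanSolution L a b c p w') (hW0 : 0 ≤ ∫ t in (0:ℝ)..L, w t)
    (hconc : ∀ x ∈ Icc 0 L, iteratedDerivWithin 2 w (Icc 0 L) x ≤ 0) :
    ∫ t in (0:ℝ)..L, w' t ≤ ∫ t in (0:ℝ)..L, w t := by
  obtain ⟨hC, hI, h0, hL0, h20, h2L⟩ := hw
  obtain ⟨hC', hI', h0', hL0', h20', h2L'⟩ := hw'
  obtain ⟨hv, hWφ⟩ := navier_reduction hL hC h0 hL0
  obtain ⟨hv', hWφ'⟩ := navier_reduction hL hC' h0' hL0'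
  set W := ∫ t in (0:ℝ)..L, w t
  set W' := ∫ t in (0:ℝ)..L, w' t
  by_contra! hlt
  have hk : 0 < a + b * W' := by
    have := hW0.trans hlt.le
    positivity
  have hm := sqrt_pos.2 hk
  have e := integral_parabola_mul hm hL (hv'.sub hv) (by simp [h20, h20']) (by simp [h2L, h2L'])
  have hD : W' - W = ∫ x in (0:ℝ)..L, x * (L - x) / 2 *
      (-iteratedDerivWithin 2 w' (Icc 0 L) x - -iteratedDerivWithin 2 w (Icc 0 L) x) := by
    rw [hWφ', hWφ, ← integral_sub]
    · simp only [mul_sub]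
    · exact (hasTwoDerivsOn_parabola.cont.mul hv'.cont).intervalIntegrable_of_Icc hL.le
    · exact (hasTwoDerivsOn_parabola.cont.mul hv.cont).intervalIntegrable_of_Icc hL.le
  obtain ⟨g₁, hg⟩ := hasTwoDerivsOn_helmholtzParabola (L := L) hm
  have hle : W' - W ≤ 0 := by
    rw [hD, e, sq_sqrt hk.le]
    refine (integral_mono_on_of_le_Ioo (g := fun _ => 0) hL.le ?_ (by simp)
      fun x hx => ?_).trans_eq (by simp)
    · exact (hg.cont.mul ((continuousOn_const.mul (hv'.sub hv).cont).sub
        (hv'.sub hv).cont₂)).intervalIntegrable_of_Icc hL.le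
    · have hx' := Ioo_subset_Icc_self hx
      refine mul_nonpos_of_nonneg_of_nonpos (helmholtzParabola_nonneg hm hL hx') ?_
      have h3 := mul_nonneg (mul_nonneg hb.le (sub_nonneg.2 hlt.le)) (neg_nonneg.2 (hconc x hx'))
      have h4 := mul_nonneg hc.le (sub_nonneg.2 hlt.le)
      linarith [hI x hx, hI' x hx]
  linarith

/-- Two solutions with the same nonnegative mean are ordered (in both directions, by symmetry). -/
theorem melanSolution_le_of_integral_eq {L a b c : ℝ} (hL : 0 < L) (ha : 0 < a) (hb : 0 < b)
    {p w w' : ℝ → ℝ} (hw : IsMelanSolution L a b c p w)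
    (hw' : IsMelanSolution L a b c p w') (hW0 : 0 ≤ ∫ t in (0:ℝ)..L, w t)
    (hW : ∫ t in (0:ℝ)..L, w' t = ∫ t in (0:ℝ)..L, w t) :
    ∀ x ∈ Icc 0 L, w' x ≤ w x := by
  obtain ⟨hC, hI, h0, hL0, h20, h2L⟩ := hw
  obtain ⟨hC', hI', h0', hL0', h20', h2L'⟩ := hw'
  have hv := (navier_reduction hL hC h0 hL0).1
  have hv' := (navier_reduction hL hC' h0' hL0').1
  have hk : 0 < a + b * ∫ t in (0:ℝ)..L, w t := by positivity
  rw [hW] at hI'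
  have hd := hv.sub hv'
  have hd0 := hd.nonneg_of_helmholtz_nonneg (sqrt_pos.2 hk) hL (by simp [h20, h20'])
    (by simp [h2L, h2L']) <| le_on_Icc_of_le_on_Ioo hL continuousOn_const
      ((continuousOn_const.mul hd.cont).sub hd.cont₂) fun x hx => by
        rw [sq_sqrt hk.le]
        linarith [hI x hx, hI' x hx]
  have hs := (hasTwoDerivsOn_iteratedDerivWithin hL hC (n := 0) (by lia)).sub
    (hasTwoDerivsOn_iteratedDerivWithin hL hC' (n := 0) (by lia))
  intro x hx
  have := hs.nonneg_of_deriv2_nonpos hL (by simp [h0, h0']) (by simp [hL0, hL0'])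
    (fun x hx => by have := hd0 x hx; simp only [zero_add]; linarith) x hx
  simpa using this

/-- Comparison of a lower and an upper solution with ordered means, given a bound on the second
derivative of one of them. -/
theorem melan_comparison {L a b c M N : ℝ} (hL : 0 < L) (ha : 0 < a) (hb : 0 < b) (hM : 0 < M)
    (hN0 : 0 < N) (hN : N ≤ 4 * M / L ^ 3 * sigmaFun (√M * L)) {p u w : ℝ → ℝ}
    (hu : IsMelanLowerSolution L a b c p u) (hw : IsMelanUpperSolution L a b c p w)
    (hU0 : 0 ≤ ∫ t in (0:ℝ)..L, u t)
    (hUW : ∫ t in (0:ℝ)..L, u t ≤ ∫ t in (0:ℝ)..L, w t)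
    (hWM : a + b * ∫ t in (0:ℝ)..L, w t ≤ M)
    (hbd : (∀ x ∈ Icc 0 L, c - b * iteratedDerivWithin 2 u (Icc 0 L) x ≤ N) ∨
      ∀ x ∈ Icc 0 L, c - b * iteratedDerivWithin 2 w (Icc 0 L) x ≤ N) :
    (∀ x ∈ Icc 0 L,
      iteratedDerivWithin 2 w (Icc 0 L) x ≤ iteratedDerivWithin 2 u (Icc 0 L) x) ∧
    ∀ x ∈ Icc 0 L, u x ≤ w x := by
  obtain ⟨hC, hI, h0, hL0, h20, h2L⟩ := hu
  obtain ⟨hC', hI', h0', hL0', h20', h2L'⟩ := hw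
  obtain ⟨hv, hUφ⟩ := navier_reduction hL hC h0 hL0
  obtain ⟨hv', hWφ⟩ := navier_reduction hL hC' h0' hL0'
  have hd := hv'.sub hv
  set U := ∫ t in (0:ℝ)..L, u t
  set W := ∫ t in (0:ℝ)..L, w t
  have hD : W - U = ∫ x in (0:ℝ)..L, x * (L - x) / 2 *
      (-iteratedDerivWithin 2 w (Icc 0 L) x - -iteratedDerivWithin 2 u (Icc 0 L) x) := by
    rw [hWφ, hUφ, ← integral_sub]
    · simp only [mul_sub]
    · exact (hasTwoDerivsOn_parabola.cont.mul hv'.cont).intervalIntegrable_of_Icc hL.le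
    · exact (hasTwoDerivsOn_parabola.cont.mul hv.cont).intervalIntegrable_of_Icc hL.le
  have hk : 0 < a + b * U := by positivity
  have hk' : 0 < a + b * W := by
    have := hU0.trans hUW
    positivity
  have hkk : a + b * U ≤ a + b * W := by gcongr
  have hord : ∀ x ∈ Icc 0 L, 0 ≤
      -iteratedDerivWithin 2 w (Icc 0 L) x - -iteratedDerivWithin 2 u (Icc 0 L) x := by
    rcases hbd with hbd | hbd
    · refine nonneg_of_nonlocal_nonneg_of_sigma hL hM hN0 hN hk' hWM hd (by simp [h20, h20'])
        (by simp [h2L, h2L']) hD ?_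
      refine le_on_Icc_of_le_on_Ioo hL continuousOn_const
        (((continuousOn_const.mul hd.cont).sub hd.cont₂).add continuousOn_const) fun x hx => ?_
      have := mul_le_mul_of_nonneg_right (hbd x (Ioo_subset_Icc_self hx)) (sub_nonneg.2 hUW)
      linarith [hI x hx, hI' x hx]
    · refine nonneg_of_nonlocal_nonneg_of_sigma hL hM hN0 hN hk (hkk.trans hWM) hd
        (by simp [h20, h20']) (by simp [h2L, h2L']) hD ?_
      refine le_on_Icc_of_le_on_Ioo hL continuousOn_const
        (((continuousOn_const.mul hd.cont).sub hd.cont₂).add continuousOn_const) fun x hx => ?_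
      have := mul_le_mul_of_nonneg_right (hbd x (Ioo_subset_Icc_self hx)) (sub_nonneg.2 hUW)
      linarith [hI x hx, hI' x hx]
  refine ⟨fun x hx => by linarith [hord x hx], fun x hx => ?_⟩
  have hs := (hasTwoDerivsOn_iteratedDerivWithin hL hC' (n := 0) (by lia)).sub
    (hasTwoDerivsOn_iteratedDerivWithin hL hC (n := 0) (by lia))
  have := hs.nonneg_of_deriv2_nonpos hL (by simp [h0, h0']) (by simp [hL0, hL0'])
    (fun x hx => by have := hord x hx; simp only [zero_add]; linarith) x hx
  simpa using this

theorem stmt15 (L a b c : ℝ) (hL : 0 < L) (ha : 0 < a) (hb : 0 < b) (hc : 0 < c)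
    (p : ℝ → ℝ) (hp : ContinuousOn p (Set.Icc 0 L))
    (M N : ℝ) (hM : 0 < M) (hN0 : 0 < N)
    (hN : N ≤ 4 * M / L ^ 3 * sigmaFun (Real.sqrt M * L))
    (α β : ℝ → ℝ)
    (hα : IsMelanLowerSolution L a b c p α)
    (hβ : IsMelanUpperSolution L a b c p β)
    (hord : ∀ x ∈ Set.Icc (0:ℝ) L, 0 ≤ α x ∧ α x ≤ β x)
    (hord'' : ∀ x ∈ Set.Icc (0:ℝ) L,
      iteratedDerivWithin 2 α (Set.Icc 0 L) x ≤ 0 ∧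
      iteratedDerivWithin 2 β (Set.Icc 0 L) x ≤ iteratedDerivWithin 2 α (Set.Icc 0 L) x)
    (hM' : a + b * ∫ t in (0:ℝ)..L, β t ≤ M)
    (hN' : c - b * sInf ((fun x => iteratedDerivWithin 2 β (Set.Icc 0 L) x) '' Set.Icc 0 L)
      ≤ N)
    (huniq : L ^ 3 / 4 * N + M - 4 / L ^ 2
      < a + b * (∫ t in (0:ℝ)..L, α t) + L ^ 3 / 4 * c) :
    ∃ w : ℝ → ℝ,
      (IsMelanSolution L a b c p w ∧
        (∀ x ∈ Set.Icc (0:ℝ) L, α x ≤ w x ∧ w x ≤ β x) ∧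
        (∀ x ∈ Set.Icc (0:ℝ) L,
          iteratedDerivWithin 2 w (Set.Icc 0 L) x ≤ iteratedDerivWithin 2 α (Set.Icc 0 L) x ∧
          iteratedDerivWithin 2 β (Set.Icc 0 L) x ≤ iteratedDerivWithin 2 w (Set.Icc 0 L) x)) ∧
      (∀ w' : ℝ → ℝ,
        (IsMelanSolution L a b c p w' ∧
          (∀ x ∈ Set.Icc (0:ℝ) L, α x ≤ w' x ∧ w' x ≤ β x) ∧
          (∀ x ∈ Set.Icc (0:ℝ) L,
            iteratedDerivWithin 2 w' (Set.Icc 0 L) x ≤ iteratedDerivWithin 2 α (Set.Icc 0 L) x ∧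
            iteratedDerivWithin 2 β (Set.Icc 0 L) x ≤ iteratedDerivWithin 2 w' (Set.Icc 0 L) x)) →
        ∀ x ∈ Set.Icc (0:ℝ) L, w' x = w x) := by
  have hmono : ∀ u w : ℝ → ℝ, ContDiffOn ℝ 4 u (Icc 0 L) → ContDiffOn ℝ 4 w (Icc 0 L) →
      (∀ x ∈ Icc (0:ℝ) L, u x ≤ w x) → ∫ t in (0:ℝ)..L, u t ≤ ∫ t in (0:ℝ)..L, w t :=
    fun u w hu hw h => integral_mono_on hL.le (hu.continuousOn.intervalIntegrable_of_Icc hL.le)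
      (hw.continuousOn.intervalIntegrable_of_Icc hL.le) h
  have hA0 : 0 ≤ ∫ t in (0:ℝ)..L, α t := integral_nonneg hL.le fun x hx => (hord x hx).1
  have hAB := hmono α β hα.1 hβ.1 fun x hx => (hord x hx).2
  have hβN : ∀ x ∈ Icc 0 L, c - b * iteratedDerivWithin 2 β (Icc 0 L) x ≤ N := by
    intro x hx
    have hcont := (hasTwoDerivsOn_iteratedDerivWithin hL hβ.1 (n := 2) (by lia)).cont
    have := csInf_le (isCompact_Icc.image_of_continuousOn hcont).bddBelow
      (mem_image_of_mem _ hx)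
    have := mul_le_mul_of_nonneg_left this hb.le
    linarith
  have hαN : ∀ x ∈ Icc 0 L, c - b * iteratedDerivWithin 2 α (Icc 0 L) x ≤ N := by
    intro x hx
    have := mul_le_mul_of_nonneg_left (hord'' x hx).2 hb.le
    linarith [hβN x hx]
  obtain ⟨w, hw, hAW, hWB⟩ := exists_melanSolution hL ha hb hp hα hβ hA0 hAB
  have hW0 := hA0.trans hAW
  have hWM : a + b * ∫ t in (0:ℝ)..L, w t ≤ M :=
    le_trans (by gcongr) hM'
  have hlow := melan_comparison hL ha hb hM hN0 hN hα
    ⟨hw.1, fun x hx => (hw.2.1 x hx).ge, hw.2.2⟩ hA0 hAW hWM (.inl hαN)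
  have hupp := melan_comparison hL ha hb hM hN0 hN
    ⟨hw.1, fun x hx => (hw.2.1 x hx).le, hw.2.2⟩ hβ hW0 hWB hM' (.inr hβN)
  refine ⟨w, ⟨hw, fun x hx => ⟨hlow.2 x hx, hupp.2 x hx⟩,
    fun x hx => ⟨hlow.1 x hx, hupp.1 x hx⟩⟩, ?_⟩
  rintro w' ⟨hw', hord', hord2'⟩ x hx
  have hW0' := hA0.trans (hmono α w' hα.1 hw'.1 fun x hx => (hord' x hx).1)
  have heq : ∫ t in (0:ℝ)..L, w' t = ∫ t in (0:ℝ)..L, w t :=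
    le_antisymm
      (melanSolution_integral_le hL ha hb hc hw hw' hW0
        fun x hx => (hlow.1 x hx).trans (hord'' x hx).1)
      (melanSolution_integral_le hL ha hb hc hw' hw hW0'
        fun x hx => (hord2' x hx).1.trans (hord'' x hx).1)
  exact le_antisymm (melanSolution_le_of_integral_eq hL ha hb hw hw' hW0 heq x hx)
    (melanSolution_le_of_integral_eq hL ha hb hw' hw hW0' heq.symm x hx)
end

section
/- Let L > 0 and a, b, c > 0 be real numbers and let p : [0,L] → ℝ be continuous and nonnegative. Suppose there exists a constant λ > 0 such that p(x) ≤ [λ·π⁴/L⁴ + a·λ·π²/L² + 2·b·λ²·π/L]·sin(π·x/L) + 2·λ·c·L/π for all x ∈ (0,L), and such that c + b·λ·π²/L² ≤ (4·(a + 2·b·λ·L/π)/L³)·σ(√(a + 2·b·λ·L/π)·L). Then the zero function α ≡ 0 is a lower solution and β(x) = λ·sin(π·x/L) is an upper solution of problem (4.1),(1.2), and there exist solutions y̲ and ȳ of (4.1),(1.2) with 0 ≤ y̲(x) ≤ ȳ(x) ≤ λ·sin(π·x/L) and 0 ≥ y̲''(x) ≥ ȳ''(x) ≥ −λ·(π²/L²)·sin(π·x/L)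 on [0,L], such that every solution w of (4.1),(1.2) with 0 ≤ w ≤ λ·sin(π·x/L) and 0 ≥ w'' ≥ −λ·(π²/L²)·sin(π·x/L) satisfies y̲ ≤ w ≤ ȳ on [0,L]. -/
open Real

/-- The data of a `C²` function on `[0,L]`: `u₁` and `u₂` are the first two derivatives of `u`. -/
structure HasTwoDerivs (L : ℝ) (u u₁ u₂ : ℝ → ℝ) : Prop where
  fst : ∀ x ∈ Set.Icc (0:ℝ) L, HasDerivWithinAt u (u₁ x) (Set.Icc 0 L) x
  snd : ∀ x ∈ Set.Icc (0:ℝ) L, HasDerivWithinAt u₁ (u₂ x) (Set.Icc 0 L) x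
  cont : ContinuousOn u₂ (Set.Icc 0 L)

namespace HasTwoDerivs

variable {L : ℝ} {u u₁ u₂ v v₁ v₂ : ℝ → ℝ}

lemma cont_zero (h : HasTwoDerivs L u u₁ u₂) : ContinuousOn u (Set.Icc 0 L) :=
  fun x hx => (h.fst x hx).continuousWithinAt

lemma cont_one (h : HasTwoDerivs L u u₁ u₂) : ContinuousOn u₁ (Set.Icc 0 L) :=
  fun x hx => (h.snd x hx).continuousWithinAt

lemma sub (hu : HasTwoDerivs L u u₁ u₂) (hv : HasTwoDerivs L v v₁ v₂) :
    HasTwoDerivs L (fun x => u x - v x) (fun x => u₁ x - v₁ x) (fun x => u₂ x - v₂ x) :=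
  ⟨fun x hx => (hu.fst x hx).sub (hv.fst x hx), fun x hx => (hu.snd x hx).sub (hv.snd x hx),
    hu.cont.sub hv.cont⟩

lemma neg (hu : HasTwoDerivs L u u₁ u₂) :
    HasTwoDerivs L (fun x => -u x) (fun x => -u₁ x) (fun x => -u₂ x) :=
  ⟨fun x hx => (hu.fst x hx).neg, fun x hx => (hu.snd x hx).neg, hu.cont.neg⟩

lemma of_hasDerivAt (h₁ : ∀ x, HasDerivAt u (u₁ x) x) (h₂ : ∀ x, HasDerivAt u₁ (u₂ x) x)
    (hc : Continuous u₂) : HasTwoDerivs L u u₁ u₂ :=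
  ⟨fun x _ => (h₁ x).hasDerivWithinAt, fun x _ => (h₂ x).hasDerivWithinAt, hc.continuousOn⟩

end HasTwoDerivs

lemma integral_of_hasDerivWithinAt {l r : ℝ} (hlr : l ≤ r) {F f : ℝ → ℝ}
    (hF : ∀ x ∈ Set.Icc l r, HasDerivWithinAt F (f x) (Set.Icc l r) x)
    (hf : ContinuousOn f (Set.Icc l r)) : ∫ t in l..r, f t = F r - F l :=
  intervalIntegral.integral_eq_sub_of_hasDerivAt_of_le hlr
    (fun x hx => (hF x hx).continuousWithinAt)
    (fun x hx => (hF x (Set.Ioo_subset_Icc_self hx)).hasDerivAt (Icc_mem_nhds hx.1 hx.2))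
    (hf.intervalIntegrable_of_Icc hlr)

lemma integral_snd_mul_eq {L : ℝ} (hL : 0 ≤ L) {u u₁ u₂ q q₁ q₂ : ℝ → ℝ}
    (hu : HasTwoDerivs L u u₁ u₂) (hq : HasTwoDerivs L q q₁ q₂)
    (hu0 : u 0 = 0) (huL : u L = 0) (hq0 : q 0 = 0) (hqL : q L = 0) :
    ∫ t in (0:ℝ)..L, u₂ t * q t = ∫ t in (0:ℝ)..L, u t * q₂ t := by
  have i1 : IntervalIntegrable (fun t => u₂ t * q t) MeasureTheory.volume 0 L :=
    (hu.cont.mul hq.cont_zero).intervalIntegrable_of_Icc hL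
  have i2 : IntervalIntegrable (fun t => u t * q₂ t) MeasureTheory.volume 0 L :=
    (hu.cont_zero.mul hq.cont).intervalIntegrable_of_Icc hL
  have h := integral_of_hasDerivWithinAt hL (F := fun t => u₁ t * q t - u t * q₁ t)
    (f := fun t => u₂ t * q t - u t * q₂ t) (fun x hx => by
      refine (((hu.snd x hx).mul (hq.fst x hx)).sub
        ((hu.fst x hx).mul (hq.snd x hx))).congr_deriv ?_
      ring) ((hu.cont.mul hq.cont_zero).sub (hu.cont_zero.mul hq.cont))
  rw [intervalIntegral.integral_sub i1 i2] at h
  simp only [hu0, huL, hq0, hqL] at h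
  linarith

lemma nonneg_of_snd_nonpos {L : ℝ} {u u₁ u₂ : ℝ → ℝ}
    (hu : HasTwoDerivs L u u₁ u₂) (hu0 : u 0 = 0) (huL : u L = 0)
    (h : ∀ x ∈ Set.Ioo (0:ℝ) L, u₂ x ≤ 0) : ∀ x ∈ Set.Icc (0:ℝ) L, 0 ≤ u x := by
  intro x hx
  have hL : 0 ≤ L := hx.1.trans hx.2
  have hsub : interior (Set.Icc 0 L) ⊆ Set.Icc 0 L := interior_subset
  have hc : ConcaveOn ℝ (Set.Icc 0 L) u :=
    concaveOn_of_hasDerivWithinAt2_nonpos (convex_Icc 0 L) hu.cont_zero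
      (fun y hy => (hu.fst y (hsub hy)).mono hsub)
      (fun y hy => (hu.snd y (hsub hy)).mono hsub)
      (fun y hy => h y (by rwa [interior_Icc] at hy))
  have := hc.min_le_of_mem_Icc (Set.left_mem_Icc.2 hL) (Set.right_mem_Icc.2 hL) hx
  simpa [hu0, huL] using this

/-- The denominator of `sigmaFun`. -/
noncomputable def sigmaDenom (x : ℝ) : ℝ :=
  6 * x * Real.cosh x + 6 * x - 12 * Real.sinh x - x ^ 3

lemma hasSum_sigmaDenom (x : ℝ) :
    HasSum (fun n : ℕ => 6 * (2 * (n:ℝ) + 3) / ((2 * (n + 2) + 1).factorial : ℝ)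
      * x ^ (2 * (n + 2) + 1)) (sigmaDenom x) := by
  have h := ((Real.hasSum_cosh x).mul_left (6 * x)).sub ((Real.hasSum_sinh x).mul_left 12)
  have h2 := (hasSum_nat_add_iff' 2).2 h
  have hf : (fun n : ℕ => 6 * (2 * (n:ℝ) + 3) / ((2 * (n + 2) + 1).factorial : ℝ)
      * x ^ (2 * (n + 2) + 1)) = fun n : ℕ =>
      6 * x * (x ^ (2 * (n + 2)) / ((2 * (n + 2)).factorial : ℝ))
        - 12 * (x ^ (2 * (n + 2) + 1) / ((2 * (n + 2) + 1).factorial : ℝ)) := by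
    funext n
    rw [Nat.factorial_succ (2 * (n + 2)), pow_succ]
    have : ((2 * (n + 2)).factorial : ℝ) ≠ 0 := by positivity
    have : (2 * ((n:ℝ) + 2) + 1) ≠ 0 := by positivity
    push_cast
    field_simp
    ring
  have hs : sigmaDenom x = 6 * x * Real.cosh x - 12 * Real.sinh x - ∑ i ∈ Finset.range 2,
      (6 * x * (x ^ (2 * i) / ((2 * i).factorial : ℝ))
        - 12 * (x ^ (2 * i + 1) / ((2 * i + 1).factorial : ℝ))) := by
    simp [Finset.sum_range_succ, sigmaDenom, Nat.factorial]
    ring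
  rw [hf, hs]
  exact h2

lemma sigmaDenom_mul_pow_le {x y : ℝ} (hx : 0 ≤ x) (hxy : x ≤ y) :
    sigmaDenom x * y ^ 5 ≤ sigmaDenom y * x ^ 5 := by
  refine hasSum_le (fun n => ?_) ((hasSum_sigmaDenom x).mul_right (y ^ 5))
    ((hasSum_sigmaDenom y).mul_right (x ^ 5))
  rw [mul_assoc, mul_assoc]
  refine mul_le_mul_of_nonneg_left ?_ (by positivity)
  have e : 2 * (n + 2) + 1 = 2 * n + 5 := by ring
  rw [e, pow_add, pow_add]
  have := pow_le_pow_left₀ hx hxy (2 * n)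
  have h5 : 0 ≤ x ^ 5 * y ^ 5 := by
    have := hx.trans hxy
    positivity
  nlinarith [mul_le_mul_of_nonneg_right this h5]

section IteratedDeriv

variable {L : ℝ} {w w₁ w₂ w₃ w₄ : ℝ → ℝ}

lemma ContDiffOn.hasTwoDerivs_iteratedDerivWithin (hL : 0 < L)
    (hw : ContDiffOn ℝ 4 w (Set.Icc 0 L)) {n : ℕ} (hn : n ≤ 2) :
    HasTwoDerivs L (iteratedDerivWithin n w (Set.Icc 0 L))
      (iteratedDerivWithin (n + 1) w (Set.Icc 0 L))
      (iteratedDerivWithin (n + 2) w (Set.Icc 0 L)) := by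
  have hs := uniqueDiffOn_Icc hL
  have key : ∀ m : ℕ, m < 4 → ∀ x ∈ Set.Icc (0:ℝ) L,
      HasDerivWithinAt (iteratedDerivWithin m w (Set.Icc 0 L))
        (iteratedDerivWithin (m + 1) w (Set.Icc 0 L) x) (Set.Icc 0 L) x := by
    intro m hm x hx
    rw [iteratedDerivWithin_succ]
    exact (hw.differentiableOn_iteratedDerivWithin (by exact_mod_cast hm) hs x
      hx).hasDerivWithinAt
  exact ⟨key n (by omega), key (n + 1) (by omega),
    hw.continuousOn_iteratedDerivWithin (by exact_mod_cast (by omega : n + 2 ≤ 4)) hs⟩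

lemma HasTwoDerivs.iteratedDerivWithin_eqOn (hL : 0 < L) {n : ℕ} {u u₁ u₂ : ℝ → ℝ}
    (hw : Set.EqOn (iteratedDerivWithin n w (Set.Icc 0 L)) u (Set.Icc 0 L))
    (hu : HasTwoDerivs L u u₁ u₂) :
    Set.EqOn (iteratedDerivWithin (n + 1) w (Set.Icc 0 L)) u₁ (Set.Icc 0 L) ∧
    Set.EqOn (iteratedDerivWithin (n + 2) w (Set.Icc 0 L)) u₂ (Set.Icc 0 L) := by
  have hs := uniqueDiffOn_Icc hL
  have h1 : Set.EqOn (iteratedDerivWithin (n + 1) w (Set.Icc 0 L)) u₁ (Set.Icc 0 L) := by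
    intro x hx
    rw [iteratedDerivWithin_succ, derivWithin_congr hw (hw hx)]
    exact (hu.fst x hx).derivWithin (hs x hx)
  refine ⟨h1, fun x hx => ?_⟩
  rw [iteratedDerivWithin_succ, derivWithin_congr h1 (h1 hx)]
  exact (hu.snd x hx).derivWithin (hs x hx)

lemma contDiffOn_four_of_hasTwoDerivs (hL : 0 < L) (h : HasTwoDerivs L w w₁ w₂)
    (h' : HasTwoDerivs L w₂ w₃ w₄) :
    ContDiffOn ℝ 4 w (Set.Icc 0 L) ∧
    Set.EqOn (iteratedDerivWithin 2 w (Set.Icc 0 L)) w₂ (Set.Icc 0 L) ∧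
    Set.EqOn (iteratedDerivWithin 4 w (Set.Icc 0 L)) w₄ (Set.Icc 0 L) := by
  have e0 : Set.EqOn (iteratedDerivWithin 0 w (Set.Icc 0 L)) w (Set.Icc 0 L) :=
    fun x _ => by rw [iteratedDerivWithin_zero]
  obtain ⟨e1, e2⟩ := h.iteratedDerivWithin_eqOn hL e0
  obtain ⟨e3, e4⟩ := h'.iteratedDerivWithin_eqOn hL e2
  refine ⟨?_, e2, e4⟩
  have hd : ∀ {u u' : ℝ → ℝ}, (∀ x ∈ Set.Icc (0:ℝ) L, HasDerivWithinAt u (u' x) (Set.Icc 0 L) x) →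
      DifferentiableOn ℝ u (Set.Icc 0 L) := fun hu x hx => (hu x hx).differentiableWithinAt
  refine contDiffOn_of_continuousOn_differentiableOn_deriv (n := 4) (fun m hm => ?_)
    (fun m hm => ?_)
  · have hm : m ≤ 4 := by exact_mod_cast hm
    interval_cases m
    · exact h.cont_zero.congr e0
    · exact h.cont_one.congr e1
    · exact h.cont.congr e2
    · exact h'.cont_one.congr e3
    · exact h'.cont.congr e4
  · have hm : m < 4 := by exact_mod_cast hm
    interval_cases m
    · exact (hd h.fst).congr e0
    · exact (hd h.snd).congr e1
    · exact (hd h'.fst).congr e2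
    · exact (hd h'.snd).congr e3

end IteratedDeriv

section Hyperbolic

lemma sinh_add_sinh_le {y t : ℝ} (hy : 0 ≤ y) (ht : 0 ≤ t) :
    Real.sinh y + Real.sinh t ≤ Real.sinh (y + t) := by
  rw [Real.sinh_add]
  nlinarith [Real.one_le_cosh y, Real.one_le_cosh t, Real.sinh_nonneg_iff.2 hy,
    Real.sinh_nonneg_iff.2 ht]

lemma sinh_sub_sinh_sub_sinh_le {y t : ℝ} (hy : 0 ≤ y) (ht : 0 ≤ t) :
    Real.sinh (y + t) - Real.sinh y - Real.sinh t ≤ (Real.cosh (y + t) - 1) * Real.sinh y := by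
  have h : Real.sinh t = Real.sinh (y + t) * Real.cosh y - Real.cosh (y + t) * Real.sinh y := by
    rw [← Real.sinh_sub]; ring_nf
  nlinarith [Real.one_le_cosh y, Real.sinh_nonneg_iff.2 (add_nonneg hy ht)]

lemma sinh_le_mul_cosh {y : ℝ} (hy : 0 ≤ y) : Real.sinh y ≤ y * Real.cosh y := by
  have hd : ∀ x, HasDerivAt (fun x => x * Real.cosh x - Real.sinh x) (x * Real.sinh x) x := by
    intro x
    refine (((hasDerivAt_id x).mul (Real.hasDerivAt_cosh x)).sub
      (Real.hasDerivAt_sinh x)).congr_deriv ?_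
    simp
  have hm : MonotoneOn (fun x => x * Real.cosh x - Real.sinh x) (Set.Ici 0) :=
    monotoneOn_of_hasDerivWithinAt_nonneg (convex_Ici 0)
      (fun x _ => (hd x).continuousAt.continuousWithinAt)
      (fun x _ => (hd x).hasDerivWithinAt)
      (fun x hx => by
        have hx : 0 < x := by simpa using hx
        exact mul_nonneg hx.le (Real.sinh_nonneg_iff.2 hx.le))
  have := hm (Set.mem_Ici.2 le_rfl) (Set.mem_Ici.2 hy) hy
  simp at this
  linarith

lemma cosh_sub_one_le {y : ℝ} (hy : 0 ≤ y) : Real.cosh y - 1 ≤ y / 2 * Real.sinh y := by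
  have h := sinh_le_mul_cosh (y := y / 2) (by linarith)
  have hs : 0 ≤ Real.sinh (y / 2) := Real.sinh_nonneg_iff.2 (by linarith)
  have e : y = 2 * (y / 2) := by ring
  rw [e, Real.cosh_two_mul, Real.sinh_two_mul, ← e, Real.cosh_sq]
  nlinarith [mul_le_mul_of_nonneg_left h hs]

end Hyperbolic

section GreenWeight

/-- The solution `g` of `-g'' + m² g = s (L - s) / 2`, `g 0 = g L = 0`. -/
noncomputable def greenWeight (L m s : ℝ) : ℝ :=
  (s * (L - s) / 2
    - (1 - (Real.sinh (m * s) + Real.sinh (m * (L - s))) / Real.sinh (m * L)) / m ^ 2) / m ^ 2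

/-- The constant `C` in the bound `greenWeight L m s ≤ C * sinh (m * s)`. -/
noncomputable def greenConst (L m : ℝ) : ℝ :=
  (L / 2 - (Real.cosh (m * L) - 1) / (m * Real.sinh (m * L))) / m ^ 3

variable {L m : ℝ}

lemma hasDerivAt_sinh_mul (m x : ℝ) :
    HasDerivAt (fun s => Real.sinh (m * s)) (m * Real.cosh (m * x)) x := by
  have := ((hasDerivAt_id x).const_mul m).sinh
  simpa [mul_comm] using this

lemma hasDerivAt_cosh_mul (m x : ℝ) :
    HasDerivAt (fun s => Real.cosh (m * s)) (m * Real.sinh (m * x)) x := by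
  have := ((hasDerivAt_id x).const_mul m).cosh
  simpa [mul_comm] using this

lemma hasDerivAt_sinh_mul_sub (L m x : ℝ) :
    HasDerivAt (fun s => Real.sinh (m * (L - s))) (-(m * Real.cosh (m * (L - x)))) x := by
  have := (((hasDerivAt_id x).const_sub L).const_mul m).sinh
  simpa [mul_comm] using this

lemma hasDerivAt_cosh_mul_sub (L m x : ℝ) :
    HasDerivAt (fun s => Real.cosh (m * (L - s))) (-(m * Real.sinh (m * (L - x)))) x := by
  have := (((hasDerivAt_id x).const_sub L).const_mul m).cosh
  simpa [mul_comm] using this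

lemma greenWeight_symm (L m s : ℝ) : greenWeight L m (L - s) = greenWeight L m s := by
  unfold greenWeight
  rw [sub_sub_cancel]
  ring

lemma hasTwoDerivs_weight (L : ℝ) : HasTwoDerivs L (fun s => s * (L - s) / 2)
    (fun s => (L - 2 * s) / 2) (fun _ => -1) := by
  refine .of_hasDerivAt (fun x => ?_) (fun x => ?_) continuous_const
  · refine (((hasDerivAt_id x).mul ((hasDerivAt_id x).const_sub L)).div_const 2).congr_deriv ?_
    simp only [id]; ring
  · refine ((((hasDerivAt_id x).const_mul 2).const_sub L).div_const 2).congr_deriv ?_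
    ring

lemma exists_hasTwoDerivs_greenWeight (hm : m ≠ 0) : ∃ g₁ : ℝ → ℝ,
    HasTwoDerivs L (greenWeight L m) g₁
      (fun s => m ^ 2 * greenWeight L m s - s * (L - s) / 2) := by
  refine ⟨fun s => ((L - 2 * s) / 2 + (Real.cosh (m * s) - Real.cosh (m * (L - s)))
    / Real.sinh (m * L) / m) / m ^ 2, .of_hasDerivAt (fun x => ?_) (fun x => ?_) ?_⟩
  · refine (((((hasDerivAt_id x).mul ((hasDerivAt_id x).const_sub L)).div_const 2).sub
      (((((hasDerivAt_sinh_mul m x).add (hasDerivAt_sinh_mul_sub L m x)).div_const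
        (Real.sinh (m * L))).const_sub 1).div_const (m ^ 2))).div_const (m ^ 2)).congr_deriv ?_
    simp only [id]
    field_simp
    ring
  · refine (((((hasDerivAt_id x).const_mul 2).const_sub L).div_const 2).add
      ((((hasDerivAt_cosh_mul m x).sub (hasDerivAt_cosh_mul_sub L m x)).div_const
        (Real.sinh (m * L))).div_const m)).div_const (m ^ 2) |>.congr_deriv ?_
    simp only [greenWeight]
    field_simp
    ring
  · unfold greenWeight
    fun_prop

lemma greenWeight_zero (hm : 0 < m) (hL : 0 < L) : greenWeight L m 0 = 0 := by
  have : Real.sinh (m * L) ≠ 0 := (Real.sinh_pos_iff.2 (mul_pos hm hL)).ne'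
  simp [greenWeight, this]

lemma greenWeight_right (hm : 0 < m) (hL : 0 < L) : greenWeight L m L = 0 := by
  rw [← greenWeight_symm, sub_self, greenWeight_zero hm hL]

lemma greenWeight_nonneg (hm : 0 < m) (hL : 0 < L) :
    ∀ s ∈ Set.Icc (0:ℝ) L, 0 ≤ greenWeight L m s := by
  obtain ⟨g₁, hg⟩ := exists_hasTwoDerivs_greenWeight (L := L) hm.ne'
  refine nonneg_of_snd_nonpos hg (greenWeight_zero hm hL) (greenWeight_right hm hL) ?_
  intro x hx
  have hS : 0 < Real.sinh (m * L) := Real.sinh_pos_iff.2 (mul_pos hm hL)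
  have h := sinh_add_sinh_le (mul_nonneg hm.le hx.1.le) (mul_nonneg hm.le (sub_nonneg.2 hx.2.le))
  rw [← mul_add, add_sub_cancel] at h
  have h' := (div_le_one hS).2 h
  have e : m ^ 2 * greenWeight L m x - x * (L - x) / 2 =
      ((Real.sinh (m * x) + Real.sinh (m * (L - x))) / Real.sinh (m * L) - 1) / m ^ 2 := by
    unfold greenWeight; field_simp; ring
  rw [e]
  exact div_nonpos_of_nonpos_of_nonneg (by linarith) (by positivity)

lemma greenWeight_le (hm : 0 < m) (hL : 0 < L) {s : ℝ} (hs : s ∈ Set.Icc 0 L) :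
    greenWeight L m s ≤ greenConst L m * Real.sinh (m * s) := by
  have hS : 0 < Real.sinh (m * L) := Real.sinh_pos_iff.2 (mul_pos hm hL)
  have hy : 0 ≤ m * s := mul_nonneg hm.le hs.1
  have h1 := cosh_sub_one_le hy
  have h2 : m * s ≤ Real.sinh (m * s) := Real.self_le_sinh_iff.2 hy
  have h3 : 0 ≤ m * (L - s) := mul_nonneg hm.le (sub_nonneg.2 hs.2)
  have e : Real.sinh (m * (L - s)) = Real.sinh (m * L) * Real.cosh (m * s)
      - Real.cosh (m * L) * Real.sinh (m * s) := by
    rw [← Real.sinh_sub]; ring_nf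
  have key : greenConst L m * Real.sinh (m * s) - greenWeight L m s =
      (m * (L - s) / 2 * (Real.sinh (m * s) - m * s) + (m * s / 2 * Real.sinh (m * s)
        - (Real.cosh (m * s) - 1))) / m ^ 4 := by
    unfold greenConst greenWeight
    rw [e]
    field_simp
    ring
  have : 0 ≤ greenConst L m * Real.sinh (m * s) - greenWeight L m s := by
    rw [key]
    refine div_nonneg (add_nonneg (mul_nonneg (by linarith) (by linarith)) (by linarith))
      (by positivity)
  linarith

lemma greenConst_nonneg (hm : 0 < m) (hL : 0 < L) : 0 ≤ greenConst L m := by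
  have hmem : L / 2 ∈ Set.Icc 0 L := ⟨by linarith, by linarith⟩
  have h := (greenWeight_nonneg hm hL _ hmem).trans (greenWeight_le hm hL hmem)
  exact nonneg_of_mul_nonneg_left h (Real.sinh_pos_iff.2 (by positivity))

lemma continuous_greenWeight (L m : ℝ) : Continuous (greenWeight L m) := by
  unfold greenWeight
  fun_prop

lemma greenConst_mul_sub_integral (hm : 0 < m) (hL : 0 < L) :
    greenConst L m * (Real.cosh (m * L) - 1) / m - ∫ s in (0:ℝ)..L, greenWeight L m s =
      sigmaDenom (m * L) / (12 * m ^ 5) := by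
  have hS : Real.sinh (m * L) ≠ 0 := (Real.sinh_pos_iff.2 (mul_pos hm hL)).ne'
  have hd : ∀ x, HasDerivAt (fun s => (L * s ^ 2 / 4 - s ^ 3 / 6
      - (s - (Real.cosh (m * s) - Real.cosh (m * (L - s))) / (m * Real.sinh (m * L))) / m ^ 2)
      / m ^ 2) (greenWeight L m x) x := by
    intro x
    refine ((((((hasDerivAt_pow 2 x).const_mul L).div_const 4).sub
      ((hasDerivAt_pow 3 x).div_const 6)).sub (((hasDerivAt_id x).sub
      (((hasDerivAt_cosh_mul m x).sub (hasDerivAt_cosh_mul_sub L m x)).div_const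
        (m * Real.sinh (m * L)))).div_const (m ^ 2))).div_const (m ^ 2)).congr_deriv ?_
    unfold greenWeight
    field_simp
    ring
  rw [intervalIntegral.integral_eq_sub_of_hasDerivAt (fun x _ => hd x)
    ((continuous_greenWeight L m).intervalIntegrable _ _)]
  simp only [sub_self, mul_zero, Real.cosh_zero, sub_zero, greenConst, sigmaDenom]
  have hc := Real.cosh_sq (m * L)
  generalize Real.cosh (m * L) = C at hc ⊢
  generalize Real.sinh (m * L) = S at hS hc ⊢
  field_simp
  linear_combination (-576) * hc

end GreenWeight

lemma sinh_mul_integral_add_eq {L m : ℝ} {z z₁ z₂ : ℝ → ℝ}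
    (hz : HasTwoDerivs L z z₁ z₂) (hz0 : z 0 = 0) (hzL : z L = 0) {x : ℝ}
    (hx : x ∈ Set.Icc 0 L) :
    Real.sinh (m * (L - x)) * (∫ s in (0:ℝ)..x, Real.sinh (m * s) * (m ^ 2 * z s - z₂ s))
      + Real.sinh (m * x) * (∫ s in x..L, Real.sinh (m * (L - s)) * (m ^ 2 * z s - z₂ s))
      = m * z x * Real.sinh (m * L) := by
  have hsubl : Set.Icc 0 x ⊆ Set.Icc 0 L := Set.Icc_subset_Icc_right hx.2
  have hsubr : Set.Icc x L ⊆ Set.Icc 0 L := Set.Icc_subset_Icc_left hx.1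
  have hcont : ContinuousOn (fun s => m ^ 2 * z s - z₂ s) (Set.Icc 0 L) :=
    (hz.cont_zero.const_mul _).sub hz.cont
  have hl := integral_of_hasDerivWithinAt hx.1
    (F := fun s => z s * (m * Real.cosh (m * s)) - z₁ s * Real.sinh (m * s))
    (f := fun s => Real.sinh (m * s) * (m ^ 2 * z s - z₂ s))
    (fun y hy => by
      refine ((((hz.fst y (hsubl hy)).mono hsubl).mul
        ((hasDerivAt_cosh_mul m y).const_mul m).hasDerivWithinAt).sub
        (((hz.snd y (hsubl hy)).mono hsubl).mul
          (hasDerivAt_sinh_mul m y).hasDerivWithinAt)).congr_deriv ?_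
      ring)
    ((Continuous.continuousOn (by fun_prop)).mul (hcont.mono hsubl))
  have hr := integral_of_hasDerivWithinAt hx.2
    (F := fun s => z s * (-(m * Real.cosh (m * (L - s)))) - z₁ s * Real.sinh (m * (L - s)))
    (f := fun s => Real.sinh (m * (L - s)) * (m ^ 2 * z s - z₂ s))
    (fun y hy => by
      refine ((((hz.fst y (hsubr hy)).mono hsubr).mul
        ((hasDerivAt_cosh_mul_sub L m y).const_mul m).neg.hasDerivWithinAt).sub
        (((hz.snd y (hsubr hy)).mono hsubr).mul
          (hasDerivAt_sinh_mul_sub L m y).hasDerivWithinAt)).congr_deriv ?_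
      simp only [Pi.neg_apply]
      ring)
    ((Continuous.continuousOn (by fun_prop)).mul (hcont.mono hsubr))
  have e : Real.sinh (m * L) = Real.sinh (m * (L - x)) * Real.cosh (m * x)
      + Real.cosh (m * (L - x)) * Real.sinh (m * x) := by
    rw [← Real.sinh_add]; ring_nf
  rw [hl, hr, e]
  simp [hz0, hzL]
  ring

lemma integral_mul_greenWeight {L m : ℝ} (hm : 0 < m) (hL : 0 < L) {z z₁ z₂ : ℝ → ℝ}
    (hz : HasTwoDerivs L z z₁ z₂) (hz0 : z 0 = 0) (hzL : z L = 0) :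
    ∫ s in (0:ℝ)..L, (m ^ 2 * z s - z₂ s) * greenWeight L m s
      = ∫ s in (0:ℝ)..L, z s * (s * (L - s) / 2) := by
  obtain ⟨g₁, hg⟩ := exists_hasTwoDerivs_greenWeight (L := L) hm.ne'
  have h := integral_snd_mul_eq hL.le hz hg hz0 hzL (greenWeight_zero hm hL)
    (greenWeight_right hm hL)
  have i1 : IntervalIntegrable (fun s => z₂ s * greenWeight L m s) MeasureTheory.volume 0 L :=
    (hz.cont.mul hg.cont_zero).intervalIntegrable_of_Icc hL.le
  have i2 : IntervalIntegrable (fun s => m ^ 2 * z s * greenWeight L m s)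
      MeasureTheory.volume 0 L :=
    ((hz.cont_zero.const_mul _).mul hg.cont_zero).intervalIntegrable_of_Icc hL.le
  have i3 : IntervalIntegrable (fun s => z s * (s * (L - s) / 2)) MeasureTheory.volume 0 L :=
    (hz.cont_zero.mul (hasTwoDerivs_weight L).cont_zero).intervalIntegrable_of_Icc hL.le
  have e : (fun s => z s * (m ^ 2 * greenWeight L m s - s * (L - s) / 2)) =
      fun s => m ^ 2 * z s * greenWeight L m s - z s * (s * (L - s) / 2) := by
    funext s; ring
  rw [e, intervalIntegral.integral_sub i2 i3] at h
  simp_rw [sub_mul]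
  rw [intervalIntegral.integral_sub i2 i1]
  linarith

/-- Maximum principle for `z ↦ -z'' + m² z + χ ∫ z q`, where `q s = s (L - s) / 2`. -/
lemma nonneg_of_nonlocal_nonneg_s16 {L m χ : ℝ} (hL : 0 < L) (hm : 0 < m) (hχ : 0 ≤ χ)
    (hD : χ * sigmaDenom (m * L) ≤ 12 * m ^ 5) {z z₁ z₂ : ℝ → ℝ}
    (hz : HasTwoDerivs L z z₁ z₂) (hz0 : z 0 = 0) (hzL : z L = 0)
    (h : ∀ x ∈ Set.Ioo (0:ℝ) L,
      0 ≤ m ^ 2 * z x - z₂ x + χ * ∫ s in (0:ℝ)..L, z s * (s * (L - s) / 2)) :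
    ∀ x ∈ Set.Icc (0:ℝ) L, 0 ≤ z x := by
  intro x hx
  have hS : 0 < Real.sinh (m * L) := Real.sinh_pos_iff.2 (mul_pos hm hL)
  set κ := ∫ s in (0:ℝ)..L, z s * (s * (L - s) / 2) with hκ
  set f : ℝ → ℝ := fun s => m ^ 2 * z s - z₂ s + χ * κ with hf
  have hfc : ContinuousOn f (Set.Icc 0 L) :=
    ((hz.cont_zero.const_mul _).sub hz.cont).add continuousOn_const
  have hf0 : ∀ s ∈ Set.Icc (0:ℝ) L, 0 ≤ f s := by
    intro s hs
    rw [← closure_Ioo hL.ne] at hs hfc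
    exact le_on_closure (f := fun _ => 0) h continuousOn_const hfc hs
  have hgc := continuous_greenWeight L m
  have hI : ∀ {l r : ℝ} {u : ℝ → ℝ}, 0 ≤ l → r ≤ L → l ≤ r → Continuous u →
      IntervalIntegrable (fun s => f s * u s) MeasureTheory.volume l r := by
    intro l r u hl hr hlr hu
    exact ((hfc.mono (Set.Icc_subset_Icc hl hr)).mul hu.continuousOn).intervalIntegrable_of_Icc hlr
  have hcl : Continuous fun s => Real.sinh (m * s) := by fun_prop
  have hcr : Continuous fun s => Real.sinh (m * (L - s)) := by fun_prop
  set γ := ∫ s in (0:ℝ)..L, greenWeight L m s with hγ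
  set P := ∫ s in (0:ℝ)..x, f s * Real.sinh (m * s) with hP
  set Q := ∫ s in x..L, f s * Real.sinh (m * (L - s)) with hQ
  set C := greenConst L m with hC
  have hC0 : 0 ≤ C := greenConst_nonneg hm hL
  have hγ0 : 0 ≤ γ := intervalIntegral.integral_nonneg hL.le (greenWeight_nonneg hm hL)
  have hP0 : 0 ≤ P := intervalIntegral.integral_nonneg hx.1 fun s hs =>
    mul_nonneg (hf0 s ⟨hs.1, hs.2.trans hx.2⟩) (Real.sinh_nonneg_iff.2 (mul_nonneg hm.le hs.1))
  have hQ0 : 0 ≤ Q := intervalIntegral.integral_nonneg hx.2 fun s hs =>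
    mul_nonneg (hf0 s ⟨hx.1.trans hs.1, hs.2⟩)
      (Real.sinh_nonneg_iff.2 (mul_nonneg hm.le (sub_nonneg.2 hs.2)))
  set A := Real.sinh (m * x) with hA
  set B := Real.sinh (m * (L - x)) with hB
  have hy : 0 ≤ m * x := mul_nonneg hm.le hx.1
  have ht : 0 ≤ m * (L - x) := mul_nonneg hm.le (sub_nonneg.2 hx.2)
  have hyt : m * x + m * (L - x) = m * L := by ring
  have hty : m * (L - x) + m * x = m * L := by ring
  have hA0 : 0 ≤ A := Real.sinh_nonneg_iff.2 hy
  have hB0 : 0 ≤ B := Real.sinh_nonneg_iff.2 ht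
  -- `E / (m² sinh (m L))` is the solution of `-u'' + m² u = 1`
  set E := (Real.sinh (m * L) - A - B) / m with hE
  set d := (Real.cosh (m * L) - 1) / m with hd
  have hE0 : 0 ≤ E := by
    have := sinh_add_sinh_le hy ht
    rw [hyt] at this
    exact div_nonneg (by linarith) hm.le
  have hEA : E ≤ d * A := by
    have := sinh_sub_sinh_sub_sinh_le hy ht
    rw [hyt] at this
    rw [hE, hd, div_mul_eq_mul_div]
    gcongr
  have hEB : E ≤ d * B := by
    have := sinh_sub_sinh_sub_sinh_le ht hy
    rw [hty] at this
    rw [hE, hd, div_mul_eq_mul_div]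
    gcongr
    linarith
  -- the two moments of the source term
  have hfg : κ * (1 + χ * γ) = ∫ s in (0:ℝ)..L, f s * greenWeight L m s := by
    have e : (fun s => f s * greenWeight L m s) = fun s =>
        (m ^ 2 * z s - z₂ s) * greenWeight L m s + χ * κ * greenWeight L m s := by
      funext s; simp only [hf]; ring
    rw [e, intervalIntegral.integral_add, integral_mul_greenWeight hm hL hz hz0 hzL,
      intervalIntegral.integral_const_mul, ← hκ, ← hγ]
    · ring
    · exact (((hz.cont_zero.const_mul _).sub hz.cont).mul
        hgc.continuousOn).intervalIntegrable_of_Icc hL.le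
    · exact (hgc.const_mul _).intervalIntegrable _ _
  have hfgle : ∫ s in (0:ℝ)..L, f s * greenWeight L m s ≤ C * (P + Q) := by
    rw [← intervalIntegral.integral_add_adjacent_intervals (hI le_rfl hx.2 hx.1 hgc)
      (hI hx.1 le_rfl hx.2 hgc), mul_add, hP, hQ, ← intervalIntegral.integral_const_mul,
      ← intervalIntegral.integral_const_mul]
    refine add_le_add
      (intervalIntegral.integral_mono_on hx.1 (hI le_rfl hx.2 hx.1 hgc)
        ((hI le_rfl hx.2 hx.1 hcl).const_mul _) fun s hs => ?_)
      (intervalIntegral.integral_mono_on hx.2 (hI hx.1 le_rfl hx.2 hgc)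
        ((hI hx.1 le_rfl hx.2 hcr).const_mul _) fun s hs => ?_)
    · have hs' : s ∈ Set.Icc 0 L := ⟨hs.1, hs.2.trans hx.2⟩
      rw [mul_left_comm]
      exact mul_le_mul_of_nonneg_left (greenWeight_le hm hL hs') (hf0 s hs')
    · have hs' : s ∈ Set.Icc 0 L := ⟨hx.1.trans hs.1, hs.2⟩
      rw [mul_left_comm, ← greenWeight_symm]
      exact mul_le_mul_of_nonneg_left
        (greenWeight_le hm hL ⟨sub_nonneg.2 hs'.2, by linarith [hs'.1]⟩) (hf0 s hs')
  have hrep : m * z x * Real.sinh (m * L) = B * P + A * Q - χ * κ * E := by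
    rw [← sinh_mul_integral_add_eq hz hz0 hzL hx]
    have hl : ∫ s in (0:ℝ)..x, Real.sinh (m * s) * (m ^ 2 * z s - z₂ s) =
        P - χ * κ * ((Real.cosh (m * x) - 1) / m) := by
      have e : (fun s => Real.sinh (m * s) * (m ^ 2 * z s - z₂ s)) = fun s =>
          f s * Real.sinh (m * s) - χ * κ * Real.sinh (m * s) := by
        funext s; simp only [hf]; ring
      have i : ∫ s in (0:ℝ)..x, Real.sinh (m * s) = (Real.cosh (m * x) - 1) / m := by
        rw [intervalIntegral.integral_eq_sub_of_hasDerivAt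
          (fun s _ => ((hasDerivAt_cosh_mul m s).div_const m).congr_deriv
            (mul_div_cancel_left₀ _ hm.ne')) (hcl.intervalIntegrable _ _)]
        simp; ring
      rw [e, intervalIntegral.integral_sub (hI le_rfl hx.2 hx.1 hcl)
        ((hcl.const_mul _).intervalIntegrable _ _), intervalIntegral.integral_const_mul, i]
    have hr : ∫ s in x..L, Real.sinh (m * (L - s)) * (m ^ 2 * z s - z₂ s) =
        Q - χ * κ * ((Real.cosh (m * (L - x)) - 1) / m) := by
      have e : (fun s => Real.sinh (m * (L - s)) * (m ^ 2 * z s - z₂ s)) = fun s =>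
          f s * Real.sinh (m * (L - s)) - χ * κ * Real.sinh (m * (L - s)) := by
        funext s; simp only [hf]; ring
      have i : ∫ s in x..L, Real.sinh (m * (L - s)) = (Real.cosh (m * (L - x)) - 1) / m := by
        rw [intervalIntegral.integral_eq_sub_of_hasDerivAt
          (fun s _ => ((hasDerivAt_cosh_mul_sub L m s).div_const (-m)).congr_deriv
            (by field_simp)) (hcr.intervalIntegrable _ _)]
        simp; field_simp; ring
      rw [e, intervalIntegral.integral_sub (hI hx.1 le_rfl hx.2 hcr)
        ((hcr.const_mul _).intervalIntegrable _ _), intervalIntegral.integral_const_mul, i]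
    have hs : Real.sinh (m * L) = A * Real.cosh (m * (L - x)) + Real.cosh (m * x) * B := by
      rw [← hyt, Real.sinh_add]
    rw [hl, hr, hE, hs]
    field_simp
    ring
  have hcond : χ * (C * d) ≤ 1 + χ * γ := by
    have h1 := greenConst_mul_sub_integral hm hL
    rw [mul_div_assoc, ← hd, ← hγ, ← hC] at h1
    have h2 : χ * (C * d - γ) ≤ 1 := by
      rw [h1, ← mul_div_assoc, div_le_one (by positivity)]
      exact hD
    linarith
  have h1 : E * ∫ s in (0:ℝ)..L, f s * greenWeight L m s ≤ C * d * (B * P + A * Q) := by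
    calc _ ≤ E * (C * (P + Q)) := mul_le_mul_of_nonneg_left hfgle hE0
      _ = C * (E * P + E * Q) := by ring
      _ ≤ C * (d * B * P + d * A * Q) := by gcongr
      _ = _ := by ring
  have h2 : 0 ≤ (1 + χ * γ) * (m * z x * Real.sinh (m * L)) := by
    have h3 : (1 + χ * γ) * (m * z x * Real.sinh (m * L)) = (1 + χ * γ) * (B * P + A * Q)
        - χ * (E * ∫ s in (0:ℝ)..L, f s * greenWeight L m s) := by
      rw [hrep, ← hfg]; ring
    have h4 : 0 ≤ B * P + A * Q := by positivity
    rw [h3]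
    nlinarith [mul_le_mul_of_nonneg_left h1 hχ, mul_le_mul_of_nonneg_right hcond h4]
  have h5 := nonneg_of_mul_nonneg_right h2 (by positivity)
  have h6 := nonneg_of_mul_nonneg_left h5 hS
  exact nonneg_of_mul_nonneg_right h6 hm

lemma exists_hasTwoDerivs_neg {L : ℝ} (hL : 0 < L) {v : ℝ → ℝ} (hv : Continuous v) :
    ∃ w w₁ : ℝ → ℝ, HasTwoDerivs L w w₁ (fun x => -v x) ∧ w 0 = 0 ∧ w L = 0 := by
  set V : ℝ → ℝ := fun x => ∫ s in (0:ℝ)..x, v s with hV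
  have hVd : ∀ x, HasDerivAt V (v x) x := fun x => hv.integral_hasStrictDerivAt 0 x |>.hasDerivAt
  have hVc : Continuous V := continuous_iff_continuousAt.2 fun x => (hVd x).continuousAt
  set c₀ := (∫ s in (0:ℝ)..L, V s) / L with hc₀
  refine ⟨fun x => c₀ * x - ∫ s in (0:ℝ)..x, V s, fun x => c₀ - V x,
    .of_hasDerivAt (fun x => ?_) (fun x => (hVd x).const_sub c₀) hv.neg, by simp, ?_⟩
  · refine (((hasDerivAt_id x).const_mul c₀).sub
      (hVc.integral_hasStrictDerivAt 0 x).hasDerivAt).congr_deriv (by simp)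
  · simp only [hc₀]
    field_simp
    ring

lemma exists_hasTwoDerivs_linear {L m : ℝ} (hL : 0 < L) (hm : 0 < m) {h : ℝ → ℝ}
    (hh : Continuous h) : ∃ v v₁ : ℝ → ℝ, Continuous v ∧
      HasTwoDerivs L v v₁ (fun x => m ^ 2 * v x - h x) ∧ v 0 = 0 ∧ v L = 0 := by
  have hS : Real.sinh (m * L) ≠ 0 := (Real.sinh_pos_iff.2 (mul_pos hm hL)).ne'
  set P : ℝ → ℝ := fun x => ∫ s in (0:ℝ)..x, Real.sinh (m * s) * h s with hP
  set R : ℝ → ℝ := fun x => ∫ s in L..x, Real.sinh (m * (L - s)) * h s with hR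
  have hPd : ∀ x, HasDerivAt P (Real.sinh (m * x) * h x) x := fun x =>
    ((by fun_prop : Continuous fun s => Real.sinh (m * s) * h s).integral_hasStrictDerivAt
      0 x).hasDerivAt
  have hRd : ∀ x, HasDerivAt R (Real.sinh (m * (L - x)) * h x) x := fun x =>
    ((by fun_prop : Continuous fun s => Real.sinh (m * (L - s)) * h s).integral_hasStrictDerivAt
      L x).hasDerivAt
  set v : ℝ → ℝ := fun x =>
    (Real.sinh (m * (L - x)) * P x - Real.sinh (m * x) * R x) / (m * Real.sinh (m * L)) with hv
  set v₁ : ℝ → ℝ := fun x =>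
    (-(m * Real.cosh (m * (L - x))) * P x - m * Real.cosh (m * x) * R x)
      / (m * Real.sinh (m * L)) with hv₁
  have hd₁ : ∀ x, HasDerivAt v (v₁ x) x := fun x => by
    refine ((((hasDerivAt_sinh_mul_sub L m x).mul (hPd x)).sub
      ((hasDerivAt_sinh_mul m x).mul (hRd x))).div_const _).congr_deriv ?_
    simp only [hv₁]
    ring
  have hd₂ : ∀ x, HasDerivAt v₁ (m ^ 2 * v x - h x) x := fun x => by
    refine (((((hasDerivAt_cosh_mul_sub L m x).const_mul m).neg.mul (hPd x)).sub
      (((hasDerivAt_cosh_mul m x).const_mul m).mul (hRd x))).div_const _).congr_deriv ?_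
    have e : Real.sinh (m * L) = Real.sinh (m * (L - x)) * Real.cosh (m * x)
        + Real.cosh (m * (L - x)) * Real.sinh (m * x) := by
      rw [← Real.sinh_add]; ring_nf
    simp only [hv, Pi.neg_apply]
    field_simp
    rw [e]
    ring
  have hvc : Continuous v := continuous_iff_continuousAt.2 fun x => (hd₁ x).continuousAt
  exact ⟨v, v₁, hvc, .of_hasDerivAt hd₁ hd₂ (by fun_prop), by simp [hv, hP], by simp [hv, hR]⟩

lemma integral_eq_integral_neg_snd {L : ℝ} (hL : 0 ≤ L) {w w₁ w₂ : ℝ → ℝ}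
    (hw : HasTwoDerivs L w w₁ w₂) (hw0 : w 0 = 0) (hwL : w L = 0) :
    ∫ s in (0:ℝ)..L, w s = ∫ s in (0:ℝ)..L, -w₂ s * (s * (L - s) / 2) := by
  have h := integral_snd_mul_eq hL hw (hasTwoDerivs_weight L) hw0 hwL (by simp) (by simp)
  simp only [neg_mul, mul_neg, mul_one, intervalIntegral.integral_neg] at h ⊢
  linarith

lemma mul_sigmaDenom_le {L M χ χ' m : ℝ} (hL : 0 < L) (hM : 0 < M) (hχ : 0 < χ)
    (hkey : χ ≤ 4 * M / L ^ 3 * sigmaFun (√M * L)) (hm : 0 < m) (hmM : m ≤ √M)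
    (hχ' : 0 ≤ χ') (hle : χ' ≤ χ) : χ' * sigmaDenom (m * L) ≤ 12 * m ^ 5 := by
  rcases le_or_gt (sigmaDenom (m * L)) 0 with h0 | h0
  · exact (mul_nonpos_of_nonneg_of_nonpos hχ' h0).trans (by positivity)
  set n := √M with hn
  have hnpos : 0 < n := Real.sqrt_pos.2 hM
  have hn2 : M = n ^ 2 := (Real.sq_sqrt hM.le).symm
  have e : 4 * M / L ^ 3 * sigmaFun (n * L) = 12 * n ^ 5 / sigmaDenom (n * L) := by
    have : sigmaFun (n * L) = 3 * (n * L) ^ 3 / sigmaDenom (n * L) := rfl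
    rw [this, hn2]
    field_simp
    ring
  rw [e] at hkey
  have hDn : 0 < sigmaDenom (n * L) := by
    by_contra hneg
    exact absurd hkey (not_le.2 ((div_nonpos_of_nonneg_of_nonpos (by positivity)
      (not_lt.1 hneg)).trans_lt hχ))
  have h1 : χ * sigmaDenom (n * L) ≤ 12 * n ^ 5 := (le_div_iff₀ hDn).1 hkey
  have h2 := sigmaDenom_mul_pow_le (x := m * L) (y := n * L) (by positivity)
    (mul_le_mul_of_nonneg_right hmM hL.le)
  rw [mul_pow, mul_pow, ← mul_assoc, ← mul_assoc] at h2
  have h3 := le_of_mul_le_mul_right h2 (by positivity)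
  have h4 : χ * sigmaDenom (m * L) * n ^ 5 ≤ 12 * m ^ 5 * n ^ 5 := by
    calc _ = χ * (sigmaDenom (m * L) * n ^ 5) := by ring
      _ ≤ χ * (sigmaDenom (n * L) * m ^ 5) := mul_le_mul_of_nonneg_left h3 hχ.le
      _ = χ * sigmaDenom (n * L) * m ^ 5 := by ring
      _ ≤ 12 * n ^ 5 * m ^ 5 := mul_le_mul_of_nonneg_right h1 (by positivity)
      _ = _ := by ring
  exact (mul_le_mul_of_nonneg_right hle h0.le).trans (le_of_mul_le_mul_right h4 (by positivity))

lemma hasTwoDerivs_sin (L A : ℝ) : HasTwoDerivs L (fun x => A * Real.sin (π * x / L))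
    (fun x => A * (π / L) * Real.cos (π * x / L))
    (fun x => -(A * (π ^ 2 / L ^ 2)) * Real.sin (π * x / L)) := by
  have hl : ∀ x, HasDerivAt (fun x => π * x / L) (π / L) x := fun x => by
    simpa using ((hasDerivAt_id x).const_mul π).div_const L
  refine .of_hasDerivAt (fun x => ?_) (fun x => ?_) (by fun_prop)
  · exact ((hl x).sin.const_mul A).congr_deriv (by ring)
  · exact ((hl x).cos.const_mul (A * (π / L))).congr_deriv (by ring)

lemma integral_sin_mul_div {L : ℝ} (hL : 0 < L) (A : ℝ) :
    ∫ t in (0:ℝ)..L, A * Real.sin (π * t / L) = 2 * A * L / π := by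
  have hd : ∀ x, HasDerivAt (fun x => -(A * L / π) * Real.cos (π * x / L))
      (A * Real.sin (π * x / L)) x := fun x => by
    have hl : HasDerivAt (fun x => π * x / L) (π / L) x := by
      simpa using ((hasDerivAt_id x).const_mul π).div_const L
    refine (hl.cos.const_mul (-(A * L / π))).congr_deriv ?_
    field_simp
  rw [intervalIntegral.integral_eq_sub_of_hasDerivAt (fun x _ => hd x)
    ((by fun_prop : Continuous fun x => A * Real.sin (π * x / L)).intervalIntegrable _ _)]
  have : π * L / L = π := by field_simp
  simp [this]
  ring

lemma sin_pi_mul_div_nonneg {L x : ℝ} (hx : x ∈ Set.Icc 0 L) : 0 ≤ Real.sin (π * x / L) := by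
  have hL : 0 ≤ L := hx.1.trans hx.2
  refine Real.sin_nonneg_of_nonneg_of_le_pi (div_nonneg (mul_nonneg pi_pos.le hx.1) hL) ?_
  exact div_le_of_le_mul₀ hL pi_pos.le (mul_le_mul_of_nonneg_left hx.2 pi_pos.le)

/-- Two concave solutions are ordered oppositely to their integrals. -/
lemma IsMelanSolution.le_of_integral_le {L a b c : ℝ} {p w w' : ℝ → ℝ} (hL : 0 < L) (ha : 0 < a)
    (hb : 0 < b) (hc : 0 < c) (hw : IsMelanSolution L a b c p w)
    (hw' : IsMelanSolution L a b c p w')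
    (hw2 : ∀ x ∈ Set.Icc (0:ℝ) L, iteratedDerivWithin 2 w (Set.Icc 0 L) x ≤ 0)
    (h0 : 0 ≤ ∫ t in (0:ℝ)..L, w' t)
    (hle : ∫ t in (0:ℝ)..L, w t ≤ ∫ t in (0:ℝ)..L, w' t)
    (hD : c * sigmaDenom (√(a + b * ∫ t in (0:ℝ)..L, w' t) * L)
      ≤ 12 * √(a + b * ∫ t in (0:ℝ)..L, w' t) ^ 5) :
    ∀ x ∈ Set.Icc (0:ℝ) L, w' x ≤ w x := by
  obtain ⟨hwC, hwE, hw0, hwL, hw20, hw2L⟩ := hw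
  obtain ⟨hwC', hwE', hw0', hwL', hw20', hw2L'⟩ := hw'
  have hA := hwC.hasTwoDerivs_iteratedDerivWithin hL (n := 0) (by norm_num)
  have hA' := hwC'.hasTwoDerivs_iteratedDerivWithin hL (n := 0) (by norm_num)
  have hB := hwC.hasTwoDerivs_iteratedDerivWithin hL (n := 2) (by norm_num)
  have hB' := hwC'.hasTwoDerivs_iteratedDerivWithin hL (n := 2) (by norm_num)
  simp only [iteratedDerivWithin_zero, zero_add] at hA hA'
  have hAA := hA.sub hA'
  have hI := integral_eq_integral_neg_snd hL.le hAA (by simp [hw0, hw0']) (by simp [hwL, hwL'])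
  rw [intervalIntegral.integral_sub (hA.cont_zero.intervalIntegrable_of_Icc hL.le)
    (hA'.cont_zero.intervalIntegrable_of_Icc hL.le)] at hI
  set k := ∫ t in (0:ℝ)..L, w t
  set k' := ∫ t in (0:ℝ)..L, w' t
  have hM : 0 < a + b * k' := by positivity
  have key := nonneg_of_nonlocal_nonneg_s16 hL (Real.sqrt_pos.2 hM) hc.le hD
    (hB.sub hB').neg (by simp [hw20, hw20']) (by simp [hw2L, hw2L']) (fun x hx => by
      rw [← hI, Real.sq_sqrt hM.le]
      have e := hwE x hx
      have e' := hwE' x hx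
      have := hw2 x (Set.Ioo_subset_Icc_self hx)
      have h3 : 0 ≤ (k' - k) * (b * -iteratedDerivWithin 2 w (Set.Icc 0 L) x) :=
        mul_nonneg (sub_nonneg.2 hle) (mul_nonneg hb.le (by linarith))
      norm_num only at e e' ⊢
      linear_combination h3 - e + e')
  intro x hx
  have := nonneg_of_snd_nonpos hAA (by simp [hw0, hw0']) (by simp [hwL, hwL'])
    (fun y hy => by linarith [key y (Set.Ioo_subset_Icc_self hy)]) x hx
  linarith

lemma exists_integral_greenWeight_eq {L a b c K : ℝ} (hL : 0 < L) (ha : 0 < a) (hb : 0 < b)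
    (hK : 0 ≤ K) {P : ℝ → ℝ} (hP : Continuous P) (hP0 : ∀ x ∈ Set.Icc (0:ℝ) L, 0 ≤ P x)
    (hle : ∫ s in (0:ℝ)..L, (P s - c * K) * greenWeight L (√(a + b * K)) s ≤ K) :
    ∃ k ∈ Set.Icc 0 K, ∫ s in (0:ℝ)..L, (P s - c * k) * greenWeight L (√(a + b * k)) s = k := by
  have hpos : ∀ k : ℝ, 0 < √(a + b * |k|) := fun k => Real.sqrt_pos.2 (by positivity)
  have hS : ∀ k : ℝ, Real.sinh (√(a + b * |k|) * L) ≠ 0 := fun k =>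
    (Real.sinh_pos_iff.2 (mul_pos (hpos k) hL)).ne'
  set Φ : ℝ → ℝ := fun k => ∫ s in (0:ℝ)..L, (P s - c * k) * greenWeight L (√(a + b * |k|)) s
    with hΦ
  have hcont : Continuous Φ := by
    refine intervalIntegral.continuous_parametric_intervalIntegral_of_continuous' ?_ _ _
    have hS' : ∀ z : ℝ × ℝ, Real.sinh (√(a + b * |z.1|) * L) ≠ 0 := fun z => hS z.1
    have hpos' : ∀ z : ℝ × ℝ, √(a + b * |z.1|) ^ 2 ≠ 0 := fun z => (pow_pos (hpos z.1) 2).ne'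
    simp only [Function.uncurry_def, greenWeight]
    fun_prop (disch := assumption)
  have h0 : 0 ≤ Φ 0 - 0 := by
    rw [sub_zero]
    exact intervalIntegral.integral_nonneg hL.le fun s hs =>
      mul_nonneg (by simpa using hP0 s hs) (greenWeight_nonneg (hpos 0) hL s hs)
  have h1 : Φ K - K ≤ 0 := by
    simp only [hΦ, abs_of_nonneg hK]
    linarith
  obtain ⟨k, hk, hk'⟩ := intermediate_value_Icc' hK (hcont.sub continuous_id).continuousOn ⟨h1, h0⟩
  refine ⟨k, hk, ?_⟩
  have : Φ k - k = 0 := hk'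
  simp only [hΦ, abs_of_nonneg hk.1] at this
  linarith

/-- Existence of a concave solution below `λ sin (π x / L)`. -/
lemma exists_isMelanSolution {L a b c : ℝ} (hL : 0 < L) (ha : 0 < a) (hb : 0 < b) (hc : 0 < c)
    {p : ℝ → ℝ} (hp : ContinuousOn p (Set.Icc 0 L)) (hp0 : ∀ x ∈ Set.Icc (0:ℝ) L, 0 ≤ p x)
    {lam : ℝ} (hlam : 0 < lam)
    (hp1 : ∀ x ∈ Set.Ioo (0:ℝ) L,
      p x ≤ (lam * π ^ 4 / L ^ 4 + a * lam * π ^ 2 / L ^ 2 + 2 * b * lam ^ 2 * π / L)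
          * Real.sin (π * x / L) + 2 * lam * c * L / π)
    (hD : ∀ k χ : ℝ, 0 ≤ k → k ≤ 2 * lam * L / π → 0 ≤ χ → χ ≤ c + b * lam * π ^ 2 / L ^ 2 →
      χ * sigmaDenom (√(a + b * k) * L) ≤ 12 * √(a + b * k) ^ 5) :
    ∃ w : ℝ → ℝ, IsMelanSolution L a b c p w ∧
      (∀ x ∈ Set.Icc (0:ℝ) L, 0 ≤ w x ∧ w x ≤ lam * Real.sin (π * x / L)) ∧
      (∀ x ∈ Set.Icc (0:ℝ) L, iteratedDerivWithin 2 w (Set.Icc 0 L) x ≤ 0 ∧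
        -(lam * (π ^ 2 / L ^ 2) * Real.sin (π * x / L))
          ≤ iteratedDerivWithin 2 w (Set.Icc 0 L) x) := by
  have hπ := pi_pos
  set K := 2 * lam * L / π with hKdef
  have hK : 0 ≤ K := by positivity
  set P : ℝ → ℝ := Set.IccExtend hL.le ((Set.Icc 0 L).domRestrict p) with hPdef
  have hPc : Continuous P := hp.domRestrict.Icc_extend'
  have hPp : ∀ x ∈ Set.Icc (0:ℝ) L, P x = p x := fun x hx => by
    rw [hPdef, Set.IccExtend_of_mem _ _ hx]; rfl
  -- the upper bound `β` and `B = -β''`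
  have hβ := hasTwoDerivs_sin L lam
  have hB := hasTwoDerivs_sin L (lam * (π ^ 2 / L ^ 2))
  have hsinL : Real.sin (π * L / L) = 0 := by
    rw [mul_div_cancel_right₀ _ hL.ne', Real.sin_pi]
  have hβK := integral_sin_mul_div hL lam
  have hBK := integral_eq_integral_neg_snd hL.le hβ (by simp) (by simp [hsinL])
  rw [hβK, ← hKdef] at hBK
  simp only [neg_mul, neg_neg] at hBK
  have hupper : ∀ x ∈ Set.Ioo (0:ℝ) L, p x - c * K ≤
      (π ^ 2 / L ^ 2 + (a + b * K)) * (lam * (π ^ 2 / L ^ 2) * Real.sin (π * x / L)) := by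
    intro x hx
    have h := hp1 x hx
    have e : (π ^ 2 / L ^ 2 + (a + b * K)) * (lam * (π ^ 2 / L ^ 2) * Real.sin (π * x / L))
        = (lam * π ^ 4 / L ^ 4 + a * lam * π ^ 2 / L ^ 2 + 2 * b * lam ^ 2 * π / L)
          * Real.sin (π * x / L) := by
      rw [hKdef]; field_simp; ring
    have e' : c * K = 2 * lam * c * L / π := by rw [hKdef]; ring
    rw [e, e']
    linarith
  have hMK : 0 < a + b * K := by positivity
  obtain ⟨k, hk, hkeq⟩ := exists_integral_greenWeight_eq (c := c) hL ha hb hK hPc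
    (fun x hx => (hPp x hx).symm ▸ hp0 x hx) (by
      have hI := integral_mul_greenWeight (Real.sqrt_pos.2 hMK) hL hB
        (by simp) (by simp [hsinL])
      rw [← hBK] at hI
      refine le_trans ?_ hI.le
      have hg := continuous_greenWeight L (√(a + b * K))
      refine intervalIntegral.integral_mono_on_of_le_Ioo hL.le
        (Continuous.intervalIntegrable (by fun_prop) _ _)
        (Continuous.intervalIntegrable (by fun_prop) _ _) fun x hx => ?_
      have hx' := Set.Ioo_subset_Icc_self hx
      refine mul_le_mul_of_nonneg_right ?_ (greenWeight_nonneg (Real.sqrt_pos.2 hMK) hL x hx')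
      rw [hPp x hx', Real.sq_sqrt hMK.le]
      linear_combination hupper x hx)
  have hM : 0 < a + b * k := by have := hk.1; positivity
  have hm : 0 < √(a + b * k) := Real.sqrt_pos.2 hM
  obtain ⟨v, v₁, hvc, hv, hv0, hvL⟩ := exists_hasTwoDerivs_linear hL hm
    (h := fun x => P x - c * k) (by fun_prop)
  obtain ⟨w, w₁, hw, hw0, hwL⟩ := exists_hasTwoDerivs_neg hL hvc
  have hvk : ∫ s in (0:ℝ)..L, v s * (s * (L - s) / 2) = k := by
    rw [← integral_mul_greenWeight hm hL hv hv0 hvL]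
    simpa only [sub_sub_cancel] using hkeq
  have hwk : ∫ s in (0:ℝ)..L, w s = k := by
    rw [integral_eq_integral_neg_snd hL.le hw hw0 hwL]
    simpa only [neg_neg] using hvk
  obtain ⟨hwC, hw2, hw4⟩ := contDiffOn_four_of_hasTwoDerivs hL hw hv.neg
  have hχ : 0 ≤ b * lam * π ^ 2 / L ^ 2 := by positivity
  have hv_nonneg : ∀ x ∈ Set.Icc (0:ℝ) L, 0 ≤ v x :=
    nonneg_of_nonlocal_nonneg_s16 hL hm hc.le (hD k c hk.1 hk.2 hc.le (by linarith)) hv hv0 hvL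
      (fun x hx => by
        have hx' := Set.Ioo_subset_Icc_self hx
        have := hp0 x hx'
        rw [hvk, hPp x hx']
        linarith)
  have hv_le := nonneg_of_nonlocal_nonneg_s16 hL hm (by positivity)
    (hD k (c + b * lam * π ^ 2 / L ^ 2) hk.1 hk.2 (by positivity) le_rfl) (hB.sub hv)
    (by simp [hv0]) (by simp [hsinL, hvL]) (fun x hx => by
      have hx' := Set.Ioo_subset_Icc_self hx
      have hI : ∫ s in (0:ℝ)..L, (lam * (π ^ 2 / L ^ 2) * Real.sin (π * s / L) - v s)
          * (s * (L - s) / 2) = K - k := by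
        simp_rw [sub_mul]
        rw [intervalIntegral.integral_sub (Continuous.intervalIntegrable (by fun_prop) _ _)
          (Continuous.intervalIntegrable (by fun_prop) _ _), hvk, ← hBK]
      rw [hI, hPp x hx', Real.sq_sqrt hM.le]
      have h1 : 0 ≤ (K - k) * (b * lam * π ^ 2 / L ^ 2 * (1 - Real.sin (π * x / L))) :=
        mul_nonneg (sub_nonneg.2 hk.2) (mul_nonneg hχ (sub_nonneg.2 (Real.sin_le_one _)))
      linear_combination h1 + hupper x hx)
  have hw_nonneg := nonneg_of_snd_nonpos hw hw0 hwL
    (fun x hx => neg_nonpos.2 (hv_nonneg x (Set.Ioo_subset_Icc_self hx)))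
  have hw_le := nonneg_of_snd_nonpos (hβ.sub hw) (by simp [hw0]) (by simp [hsinL, hwL])
    (fun x hx => by linarith [hv_le x (Set.Ioo_subset_Icc_self hx)])
  refine ⟨w, ⟨hwC, fun x hx => ?_, hw0, hwL, ?_, ?_⟩, fun x hx => ⟨hw_nonneg x hx, ?_⟩,
    fun x hx => ?_⟩
  · have hx' := Set.Ioo_subset_Icc_self hx
    rw [hw4 hx', hw2 hx', hwk]
    simp only [hPp x hx', Real.sq_sqrt hM.le]
    ring
  · rw [hw2 (Set.left_mem_Icc.2 hL.le)]; simp [hv0]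
  · rw [hw2 (Set.right_mem_Icc.2 hL.le)]; simp [hvL]
  · linarith [hw_le x hx]
  · rw [hw2 hx]
    exact ⟨neg_nonpos.2 (hv_nonneg x hx), neg_le_neg (by linarith [hv_le x hx])⟩

theorem stmt16 (L a b c : ℝ) (hL : 0 < L) (ha : 0 < a) (hb : 0 < b) (hc : 0 < c)
    (p : ℝ → ℝ) (hp : ContinuousOn p (Set.Icc 0 L))
    (hp0 : ∀ x ∈ Set.Icc (0:ℝ) L, 0 ≤ p x)
    (lam : ℝ) (hlam : 0 < lam)
    (hp1 : ∀ x ∈ Set.Ioo (0:ℝ) L,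
      p x ≤ (lam * π ^ 4 / L ^ 4 + a * lam * π ^ 2 / L ^ 2 + 2 * b * lam ^ 2 * π / L)
          * Real.sin (π * x / L) + 2 * lam * c * L / π)
    (hkey : c + b * lam * π ^ 2 / L ^ 2
      ≤ 4 * (a + 2 * b * lam * L / π) / L ^ 3
          * sigmaFun (Real.sqrt (a + 2 * b * lam * L / π) * L)) :
    IsMelanLowerSolution L a b c p (fun _ => 0) ∧
    IsMelanUpperSolution L a b c p (fun x => lam * Real.sin (π * x / L)) ∧
    ∃ ylo yhi : ℝ → ℝ,
      IsMelanSolution L a b c p ylo ∧ IsMelanSolution L a b c p yhi ∧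
      (∀ x ∈ Set.Icc (0:ℝ) L,
        0 ≤ ylo x ∧ ylo x ≤ yhi x ∧ yhi x ≤ lam * Real.sin (π * x / L)) ∧
      (∀ x ∈ Set.Icc (0:ℝ) L,
        iteratedDerivWithin 2 ylo (Set.Icc 0 L) x ≤ 0 ∧
        iteratedDerivWithin 2 yhi (Set.Icc 0 L) x ≤ iteratedDerivWithin 2 ylo (Set.Icc 0 L) x ∧
        -(lam * (π ^ 2 / L ^ 2) * Real.sin (π * x / L))
          ≤ iteratedDerivWithin 2 yhi (Set.Icc 0 L) x) ∧
      (∀ w : ℝ → ℝ, IsMelanSolution L a b c p w →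
        (∀ x ∈ Set.Icc (0:ℝ) L, 0 ≤ w x ∧ w x ≤ lam * Real.sin (π * x / L)) →
        (∀ x ∈ Set.Icc (0:ℝ) L,
          iteratedDerivWithin 2 w (Set.Icc 0 L) x ≤ 0 ∧
          -(lam * (π ^ 2 / L ^ 2) * Real.sin (π * x / L))
            ≤ iteratedDerivWithin 2 w (Set.Icc 0 L) x) →
        ∀ x ∈ Set.Icc (0:ℝ) L, ylo x ≤ w x ∧ w x ≤ yhi x) := by
  have hπ := pi_pos
  have hK : 0 < 2 * lam * L / π := by positivity
  have hM : a + 2 * b * lam * L / π = a + b * (2 * lam * L / π) := by ring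
  rw [hM] at hkey
  have hD : ∀ k χ : ℝ, 0 ≤ k → k ≤ 2 * lam * L / π → 0 ≤ χ → χ ≤ c + b * lam * π ^ 2 / L ^ 2 →
      χ * sigmaDenom (√(a + b * k) * L) ≤ 12 * √(a + b * k) ^ 5 := by
    intro k χ hk hkK hχ hle
    exact mul_sigmaDenom_le hL (by positivity) (by positivity) hkey
      (Real.sqrt_pos.2 (by positivity)) (Real.sqrt_le_sqrt (by gcongr)) hχ hle
  have hχ : c ≤ c + b * lam * π ^ 2 / L ^ 2 := le_add_of_nonneg_right (by positivity)
  refine ⟨?_, ?_, ?_⟩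
  · have h0 : HasTwoDerivs L (fun _ => 0) (fun _ => 0) (fun _ => 0) :=
      .of_hasDerivAt (fun x => hasDerivAt_const x 0) (fun x => hasDerivAt_const x 0)
        continuous_const
    obtain ⟨hC, h2, h4⟩ := contDiffOn_four_of_hasTwoDerivs hL h0 h0
    refine ⟨hC, fun x hx => ?_, rfl, rfl, h2 (Set.left_mem_Icc.2 hL.le),
      h2 (Set.right_mem_Icc.2 hL.le)⟩
    have hx' := Set.Ioo_subset_Icc_self hx
    rw [h4 hx', h2 hx']
    simpa using hp0 x hx'
  · obtain ⟨hC, h2, h4⟩ := contDiffOn_four_of_hasTwoDerivs hL (hasTwoDerivs_sin L lam)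
      (hasTwoDerivs_sin L (-(lam * (π ^ 2 / L ^ 2))))
    have hπL : π * L / L = π := mul_div_cancel_right₀ _ hL.ne'
    refine ⟨hC, fun x hx => ?_, by simp, by simp [hπL], ?_, ?_⟩
    · have hx' := Set.Ioo_subset_Icc_self hx
      rw [h4 hx', h2 hx', integral_sin_mul_div hL]
      refine (hp1 x hx).trans (le_of_eq ?_)
      field_simp
      ring
    · rw [h2 (Set.left_mem_Icc.2 hL.le)]; simp
    · rw [h2 (Set.right_mem_Icc.2 hL.le)]; simp [hπL]
  · obtain ⟨y, hy, hyb, hy2⟩ := exists_isMelanSolution hL ha hb hc hp hp0 hlam hp1 hD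
    have hint : ∀ u, IsMelanSolution L a b c p u →
        (∀ x ∈ Set.Icc (0:ℝ) L, 0 ≤ u x ∧ u x ≤ lam * Real.sin (π * x / L)) →
        0 ≤ ∫ t in (0:ℝ)..L, u t ∧ ∫ t in (0:ℝ)..L, u t ≤ 2 * lam * L / π := by
      intro u hu hub
      refine ⟨intervalIntegral.integral_nonneg hL.le fun x hx => (hub x hx).1, ?_⟩
      rw [← integral_sin_mul_div hL]
      exact intervalIntegral.integral_mono_on hL.le
        (hu.1.continuousOn.intervalIntegrable_of_Icc hL.le)
        (Continuous.intervalIntegrable (by fun_prop) _ _) fun x hx => (hub x hx).2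
    have hle : ∀ u w, IsMelanSolution L a b c p u → IsMelanSolution L a b c p w →
        (∀ x ∈ Set.Icc (0:ℝ) L, 0 ≤ w x ∧ w x ≤ lam * Real.sin (π * x / L)) →
        (∀ x ∈ Set.Icc (0:ℝ) L, iteratedDerivWithin 2 u (Set.Icc 0 L) x ≤ 0) →
        ∫ t in (0:ℝ)..L, u t ≤ ∫ t in (0:ℝ)..L, w t →
        (∀ x ∈ Set.Icc (0:ℝ) L, w x ≤ u x) ∧
          ∫ t in (0:ℝ)..L, w t ≤ ∫ t in (0:ℝ)..L, u t := by
      intro u w hu hw hwb hu2 huw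
      obtain ⟨h0, h1⟩ := hint w hw hwb
      have h := hu.le_of_integral_le hL ha hb hc hw hu2 h0 huw (hD _ c h0 h1 hc.le hχ)
      exact ⟨h, intervalIntegral.integral_mono_on hL.le
        (hw.1.continuousOn.intervalIntegrable_of_Icc hL.le)
        (hu.1.continuousOn.intervalIntegrable_of_Icc hL.le) h⟩
    refine ⟨y, y, hy, hy, fun x hx => ⟨(hyb x hx).1, le_rfl, (hyb x hx).2⟩,
      fun x hx => ⟨(hy2 x hx).1, le_rfl, (hy2 x hx).2⟩, ?_⟩
    intro w hw hwb hw2 x hx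
    rcases le_total (∫ t in (0:ℝ)..L, y t) (∫ t in (0:ℝ)..L, w t) with h | h
    · obtain ⟨h1, h2⟩ := hle y w hy hw hwb (fun x hx => (hy2 x hx).1) h
      exact ⟨(hle w y hw hy hyb (fun x hx => (hw2 x hx).1) h2).1 x hx, h1 x hx⟩
    · obtain ⟨h1, h2⟩ := hle w y hw hy hyb (fun x hx => (hw2 x hx).1) h
      exact ⟨h1 x hx, (hle y w hy hw hwb (fun x hx => (hy2 x hx).1) h2).1 x hx⟩
end
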